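/- Let G be a finite simple graph on the vertex set {1,…,ℓ}. If G is weakly chordal, then the projective dimension of the S-module D(A(G)) is at most 1. -/

import Mathlib

open MvPolynomial CategoryTheory

/-- The polynomial ring `S = ℚ[x_1, …, x_ℓ]` (variables indexed by `Fin ℓ`). -/
abbrev Spoly (ℓ : ℕ) : Type := MvPolynomial (Fin ℓ) ℚ

/-- The module `D(A(G))` of logarithmic derivations of the graphic arrangement of a
graph `G` on the vertex set `{1, …, ℓ}`: all `θ ∈ Der_ℚ(S)` such that `(x_i - x_j)`
divides `θ(x_i) - θ(x_j)` for every edge `{i, j}` of `G`. -/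
noncomputable def logDer (ℓ : ℕ) (G : SimpleGraph (Fin ℓ)) :
    Submodule (Spoly ℓ) (Derivation ℚ (Spoly ℓ) (Spoly ℓ)) where
  carrier := {θ | ∀ i j : Fin ℓ, G.Adj i j → (X i - X j) ∣ θ (X i) - θ (X j)}
  add_mem' := by
    intro a b ha hb i j h
    have : (a + b) (X i) - (a + b) (X j)
        = (a (X i) - a (X j)) + (b (X i) - b (X j)) := by
      simp only [Derivation.add_apply]; ring
    rw [this]
    exact dvd_add (ha i j h) (hb i j h)
  zero_mem' := by intro i j h; simp
  smul_mem' := by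
    intro c θ hθ i j h
    have : (c • θ) (X i) - (c • θ) (X j) = c * (θ (X i) - θ (X j)) := by
      simp only [Derivation.smul_apply, smul_eq_mul]; ring
    rw [this]
    exact (hθ i j h).mul_left c

/-- `pdLE M n` : `M` admits a projective resolution vanishing in homological
degrees above `n`, i.e. the projective dimension of `M` is at most `n`. -/
def pdLE {R : Type} [CommRing R] (M : ModuleCat R) (n : ℕ) : Prop :=
  ∃ P : ProjectiveResolution M, ∀ i : ℕ, n < i → Limits.IsZero (P.complex.X i)

/-- The projective dimension of a module, as an element of `ℕ∞`
(infimum of the lengths of projective resolutions; `⊤` if there is none of finite length). -/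
noncomputable def pd {R : Type} [CommRing R] (M : ModuleCat R) : ℕ∞ :=
  sInf {n : ℕ∞ | ∃ k : ℕ, (k : ℕ∞) = n ∧ pdLE M k}

/-- `G` contains an induced cycle of length `n`, i.e. an induced subgraph
isomorphic to the cycle graph on `n` vertices. -/
def HasInducedCycleLen {V : Type} (G : SimpleGraph V) (n : ℕ) : Prop :=
  ∃ s : Set V, Nonempty (G.induce s ≃g SimpleGraph.cycleGraph n)

/-- A graph is chordal if it has no induced cycle of length at least 4. -/
def Chordal {V : Type} (G : SimpleGraph V) : Prop :=
  ∀ n : ℕ, 4 ≤ n → ¬ HasInducedCycleLen G n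

/-- A graph is weakly chordal if neither it nor its complement contains an
induced cycle of length at least 5. -/
def WeaklyChordal {V : Type} (G : SimpleGraph V) : Prop :=
  (∀ n : ℕ, 5 ≤ n → ¬ HasInducedCycleLen G n) ∧
  (∀ n : ℕ, 5 ≤ n → ¬ HasInducedCycleLen Gᶜ n)

/-- The chain complex `⋯ → 0 → K → P` with `P` in degree `0`. -/
noncomputable def twoTermComplex {C : Type*} [Category C] [Abelian C] {K P : C} (f : K ⟶ P) :
    ChainComplex C ℕ where
  X n := match n with
    | 0 => P
    | 1 => K
    | _ + 2 => (Limits.HasZeroObject.zero' C).zero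
  d i j := match i, j with
    | 1, 0 => f
    | 0, _ => 0
    | 1, _ + 1 => 0
    | _ + 2, _ => 0
  shape i j h := by
    match i, j with
    | 1, 0 => simp at h
    | 0, _ => rfl
    | 1, _ + 1 => rfl
    | _ + 2, _ => rfl
  d_comp_d' i j k h h' := by
    obtain rfl : k + 1 = j := h'
    obtain rfl : k + 1 + 1 = i := h
    exact Limits.zero_comp

theorem twoTermComplex_d {C : Type*} [Category C] [Abelian C] {K P : C} (f : K ⟶ P) :
    (twoTermComplex f).d 1 0 = f :=
  rfl

theorem isZero_twoTermComplex_X {C : Type*} [Category C] [Abelian C] {K P : C} (f : K ⟶ P)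
    (n : ℕ) : Limits.IsZero ((twoTermComplex f).X (n + 2)) :=
  Limits.isZero_zero C

/-- The projective resolution of length one given by a short exact sequence whose
first two terms are projective. -/
noncomputable def twoTermResolution {C : Type*} [Category C] [Abelian C] (S : ShortComplex C)
    (hS : S.ShortExact) (h₁ : Projective S.X₁) (h₂ : Projective S.X₂) :
    ProjectiveResolution S.X₃ where
  complex := twoTermComplex S.f
  projective n := match n with
    | 0 => h₂
    | 1 => h₁
    | n + 2 => (isZero_twoTermComplex_X S.f n).projective
  π := (ChainComplex.toSingle₀Equiv _ _).symm ⟨S.g, by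
    rw [twoTermComplex_d]; exact S.zero⟩
  quasiIso := ⟨fun n => by
    match n with
    | 0 =>
      rw [ChainComplex.quasiIsoAt₀_iff, ShortComplex.quasiIso_iff_of_zeros']
      · refine (ShortComplex.exact_and_epi_g_iff_of_iso ?_).2 ⟨hS.exact, hS.epi_g⟩
        exact ShortComplex.isoMk (Iso.refl _) (Iso.refl _) (Iso.refl _)
          ((Category.id_comp _).trans
            ((twoTermComplex_d S.f).symm.trans (Category.comp_id _).symm))
          ((Category.id_comp _).trans
            (Eq.trans (ChainComplex.toSingle₀Equiv_symm_apply_f_zero (C := twoTermComplex S.f)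
              S.g S.zero).symm (Category.comp_id _).symm))
      all_goals rfl
    | 1 =>
      rw [quasiIsoAt_iff_exactAt']
      · rw [HomologicalComplex.exactAt_iff' _ 2 1 0 (by simp) (by simp)]
        rw [ShortComplex.exact_iff_mono]
        · have := hS.mono_f
          exact this
        · exact (isZero_twoTermComplex_X S.f 0).eq_of_src _ _
      · apply ChainComplex.exactAt_succ_single_obj
    | n + 2 =>
      rw [quasiIsoAt_iff_exactAt']
      · rw [HomologicalComplex.exactAt_iff' _ (n + 3) (n + 2) (n + 1) (by simp) (by simp)]
        exact ShortComplex.exact_of_isZero_X₂ _ (isZero_twoTermComplex_X S.f n)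
      · apply ChainComplex.exactAt_succ_single_obj⟩

/-- The projective dimension of `M` is at most one. -/
def PdLEOne (R : Type) [CommRing R] (M : Type) [AddCommGroup M] [Module R M] : Prop :=
  HasProjectiveDimensionLT (ModuleCat.of R M) 2

section
variable {R : Type} [CommRing R] {M N P : Type} [AddCommGroup M] [AddCommGroup N] [AddCommGroup P]
  [Module R M] [Module R N] [Module R P]

theorem shortExact_of_linearMap (f : M →ₗ[R] N) (g : N →ₗ[R] P) (hf : Function.Injective f)
    (hfg : Function.Exact f g) (hg : Function.Surjective g) :
    (ShortComplex.mk (ModuleCat.ofHom f) (ModuleCat.ofHom g) (by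
      rw [← ModuleCat.ofHom_comp, hfg.linearMap_comp_eq_zero]; rfl)).ShortExact where
  exact := by
    rw [ShortComplex.ShortExact.moduleCat_exact_iff_function_exact]
    exact hfg
  mono_f := (ModuleCat.mono_iff_injective _).2 hf
  epi_g := (ModuleCat.epi_iff_surjective _).2 hg

theorem pdLEOne_of_projective [Module.Projective R M] : PdLEOne R M := by
  have : Projective (ModuleCat.of R M) := (IsProjective.iff_projective M).1 inferInstance
  exact hasProjectiveDimensionLT_of_ge _ 1 2 (by norm_num)

theorem PdLEOne.middle (f : M →ₗ[R] N) (g : N →ₗ[R] P) (hf : Function.Injective f)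
    (hfg : Function.Exact f g) (hg : Function.Surjective g) (hM : PdLEOne R M)
    (hP : PdLEOne R P) : PdLEOne R N :=
  (shortExact_of_linearMap f g hf hfg hg).hasProjectiveDimensionLT_X₂ 2 hM hP

theorem PdLEOne.of_prod (h : PdLEOne R (M × N)) : PdLEOne R M :=
  have : HasProjectiveDimensionLT (ModuleCat.of R (M × N)) 2 := h
  Retract.hasProjectiveDimensionLT
    { i := ModuleCat.ofHom (LinearMap.inl R M N)
      r := ModuleCat.ofHom (LinearMap.fst R M N)
      retract := by ext; simp } 2

theorem PdLEOne.of_equiv (h : PdLEOne R M) (e : M ≃ₗ[R] N) : PdLEOne R N :=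
  have : HasProjectiveDimensionLT (ModuleCat.of R M) 2 := h
  hasProjectiveDimensionLT_of_iso e.toModuleIso 2

theorem pdLEOne_of_presentation [Module.Projective R M] [Module.Projective R N]
    (f : M →ₗ[R] N) (g : N →ₗ[R] P) (hf : Function.Injective f)
    (hfg : Function.Exact f g) (hg : Function.Surjective g) : PdLEOne R P :=
  have : Projective (ModuleCat.of R M) := (IsProjective.iff_projective M).1 inferInstance
  (shortExact_of_linearMap f g hf hfg hg).hasProjectiveDimensionLT_X₃ 1
    (projective_iff_hasProjectiveDimensionLT_one.1 this)
    pdLEOne_of_projective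

theorem PdLEOne.pd_le_one (h : PdLEOne R M) : pd (ModuleCat.of R M) ≤ 1 := by
  obtain ⟨g, hg⟩ : ∃ g : (M →₀ R) →ₗ[R] M, Function.Surjective g :=
    ⟨Finsupp.linearCombination R id, Finsupp.linearCombination_id_surjective R M⟩
  have hS := shortExact_of_linearMap (M := LinearMap.ker g) (LinearMap.ker g).subtype g
    Subtype.val_injective (LinearMap.exact_subtype_ker_map g) hg
  have hF : Projective (ModuleCat.of R (M →₀ R)) :=
    (IsProjective.iff_projective (M →₀ R)).1 inferInstance
  have hK : Projective (ModuleCat.of R (LinearMap.ker g)) := by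
    rw [projective_iff_hasProjectiveDimensionLT_one]
    exact (hS.hasProjectiveDimensionLT_X₃_iff 0 hF).1 h
  refine sInf_le ⟨1, rfl, twoTermResolution _ hS hK hF, fun i hi => ?_⟩
  obtain ⟨n, rfl⟩ := Nat.exists_eq_add_of_le' hi
  exact isZero_twoTermComplex_X _ n

end

section SubstitutionOfVariables

variable {V : Type}

theorem X_sub_X_ne_zero {a b : V} (h : a ≠ b) : (X a - X b : MvPolynomial V ℚ) ≠ 0 :=
  sub_ne_zero.2 fun h' => h (X_injective h')

/-- The product of the linear forms `X b - X c` over `c ∈ A`. -/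
noncomputable def diffProd (b : V) (A : Finset V) : MvPolynomial V ℚ := ∏ c ∈ A, (X b - X c)

theorem diffProd_ne_zero {b : V} {A : Finset V} (h : b ∉ A) : diffProd b A ≠ 0 :=
  Finset.prod_ne_zero_iff.2 fun _ hc => X_sub_X_ne_zero (ne_of_mem_of_not_mem hc h).symm

variable [DecidableEq V]

/-- The substitution `X a ↦ X b` of polynomial rings. -/
noncomputable def substVar (a b : V) : MvPolynomial V ℚ →ₐ[ℚ] MvPolynomial V ℚ :=
  aeval (Function.update X a (X b))

theorem substVar_X_self (a b : V) : substVar a b (X a) = X b := by simp [substVar]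

theorem substVar_X_of_ne {a c : V} (b : V) (h : c ≠ a) : substVar a b (X c) = X c := by
  simp [substVar, h]

theorem X_sub_X_dvd_sub_substVar (a b : V) (g : MvPolynomial V ℚ) :
    X a - X b ∣ g - substVar a b g := by
  let I : Ideal (MvPolynomial V ℚ) := Ideal.span {X a - X b}
  have key : ((Ideal.Quotient.mkₐ ℚ I).comp (substVar a b)) = Ideal.Quotient.mkₐ ℚ I := by
    ext c
    by_cases h : c = a
    · subst h
      rw [AlgHom.comp_apply, substVar_X_self]
      refine (Ideal.Quotient.eq.2 ?_).symm
      exact Ideal.mem_span_singleton_self _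
    · rw [AlgHom.comp_apply, substVar_X_of_ne b h]
  rw [← Ideal.mem_span_singleton]
  exact Ideal.Quotient.eq.1 (DFunLike.congr_fun key g).symm

theorem X_sub_X_dvd_iff (a b : V) (g : MvPolynomial V ℚ) :
    X a - X b ∣ g ↔ substVar a b g = 0 := by
  constructor
  · rintro ⟨h, rfl⟩
    by_cases hab : b = a
    · simp [hab]
    · simp [substVar_X_self, substVar_X_of_ne b hab]
  · intro h
    simpa [h] using X_sub_X_dvd_sub_substVar a b g

theorem substVar_substVar (a b : V) (g : MvPolynomial V ℚ) :
    substVar a b (substVar a b g) = substVar a b g := by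
  have := (X_sub_X_dvd_iff a b _).1 (X_sub_X_dvd_sub_substVar a b g)
  rw [map_sub, sub_eq_zero] at this
  exact this.symm

theorem prime_X_sub_X {a b : V} (h : a ≠ b) : Prime (X a - X b : MvPolynomial V ℚ) := by
  refine ⟨X_sub_X_ne_zero h, fun hu => ?_, fun p q => ?_⟩
  · have := (X_sub_X_dvd_iff a b 1).1 hu.dvd
    simp at this
  · simp only [X_sub_X_dvd_iff, map_mul, mul_eq_zero, imp_self]

theorem isRelPrime_X_sub_X {b c d : V} (hc : c ≠ b) (hd : d ≠ b) (h : c ≠ d) :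
    IsRelPrime (X b - X c : MvPolynomial V ℚ) (X b - X d) := by
  refine (prime_X_sub_X hc.symm).irreducible.isRelPrime_iff_not_dvd.2 fun hdvd => ?_
  rw [← neg_dvd, neg_sub, X_sub_X_dvd_iff, map_sub, substVar_X_of_ne b hc.symm,
    substVar_X_of_ne b h.symm] at hdvd
  exact X_sub_X_ne_zero hd.symm hdvd

theorem isRelPrime_diffProd {b : V} {A B : Finset V} (hA : b ∉ A) (hB : b ∉ B)
    (h : Disjoint A B) : IsRelPrime (diffProd b A) (diffProd b B) :=
  IsRelPrime.prod_left fun _ hc => IsRelPrime.prod_right fun _ hd =>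
    isRelPrime_X_sub_X (ne_of_mem_of_not_mem hc hA) (ne_of_mem_of_not_mem hd hB)
      (ne_of_mem_of_not_mem hd (Finset.disjoint_left.1 h hc)).symm

theorem substVar_diffProd {a b : V} {A : Finset V} (ha : a ∉ A) (hab : a ≠ b) :
    substVar a b (diffProd b A) = diffProd b A := by
  rw [diffProd, map_prod]
  refine Finset.prod_congr rfl fun c hc => ?_
  rw [map_sub, substVar_X_of_ne b hab.symm, substVar_X_of_ne b (ne_of_mem_of_not_mem hc ha)]

theorem substVar_diffProd_left {a b : V} {A : Finset V} (ha : a ∉ A) :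
    substVar a b (diffProd a A) = diffProd b A := by
  rw [diffProd, map_prod]
  refine Finset.prod_congr rfl fun c hc => ?_
  rw [map_sub, substVar_X_self, substVar_X_of_ne b (ne_of_mem_of_not_mem hc ha)]

theorem diffProd_mul_mem_span_pair {b u : V} {W B : Finset V} (hW : b ∉ W) (hB : b ∉ B)
    (hub : u ≠ b) (huW : u ∉ W) (huB : u ∉ B) (hWB : Disjoint W B) {h : MvPolynomial V ℚ}
    (hh : diffProd b W * h ∈ Ideal.span {X b - X u, diffProd b B}) :
    h ∈ Ideal.span {X b - X u, diffProd b B} := by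
  obtain ⟨p, q, hpq⟩ := Ideal.mem_span_pair.1 hh
  have h0 := congrArg (substVar u b) hpq
  rw [map_add, map_mul, map_mul, map_mul, map_sub, substVar_X_self, substVar_X_of_ne b hub.symm,
    sub_self, mul_zero, zero_add, substVar_diffProd huB hub, substVar_diffProd huW hub] at h0
  obtain ⟨k, hk⟩ : diffProd b B ∣ substVar u b h :=
    (isRelPrime_diffProd hB hW hWB.symm).dvd_of_dvd_mul_left ⟨_, by rw [← h0, mul_comm]⟩
  obtain ⟨m, hm⟩ := X_sub_X_dvd_sub_substVar u b h
  refine Ideal.mem_span_pair.2 ⟨-m, k, ?_⟩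
  linear_combination -hm - hk

theorem mem_span_pair_diffProd_right {b u : V} {B : Finset V} (hB : b ∉ B) (hub : u ≠ b)
    (huB : u ∉ B) {g : MvPolynomial V ℚ}
    (hg : ∀ v ∈ B, g ∈ Ideal.span {X b - X u, X b - X v}) :
    g ∈ Ideal.span {X b - X u, diffProd b B} := by
  induction B using Finset.induction_on with
  | empty =>
    exact Ideal.mem_span_pair.2 ⟨0, g, by simp [diffProd]⟩
  | insert v B hv ih =>
    simp only [Finset.mem_insert, not_or] at hB huB
    obtain ⟨p, q, hpq⟩ := Ideal.mem_span_pair.1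
      (ih hB.2 huB.2 fun w hw => hg w (Finset.mem_insert_of_mem hw))
    have hv1 : diffProd b {v} = X b - X v := by simp [diffProd]
    have h1 : diffProd b B * q ∈ Ideal.span {X b - X u, diffProd b {v}} := by
      obtain ⟨p', q', hpq'⟩ := Ideal.mem_span_pair.1 (hg v (Finset.mem_insert_self _ _))
      refine Ideal.mem_span_pair.2 ⟨p' - p, q', ?_⟩
      rw [hv1]
      linear_combination hpq' - hpq
    obtain ⟨r, s, hrs⟩ := Ideal.mem_span_pair.1 (diffProd_mul_mem_span_pair hB.2
      (by simpa using hB.1) hub huB.2 (by simpa using huB.1) (by simpa using hv) h1)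
    refine Ideal.mem_span_pair.2 ⟨p + diffProd b B * r, s, ?_⟩
    rw [hv1] at hrs
    have : diffProd b (insert v B) = (X b - X v) * diffProd b B := Finset.prod_insert hv
    rw [this]
    linear_combination hpq + diffProd b B * hrs

theorem mem_span_pair_diffProd_left {b : V} {A B : Finset V} (hA : b ∉ A) (hB : b ∉ B)
    (hAB : Disjoint A B) {g : MvPolynomial V ℚ}
    (hg : ∀ u ∈ A, g ∈ Ideal.span {X b - X u, diffProd b B}) :
    g ∈ Ideal.span {diffProd b A, diffProd b B} := by
  induction A using Finset.induction_on with
  | empty => exact Ideal.mem_span_pair.2 ⟨g, 0, by simp [diffProd]⟩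
  | insert u A hu ih =>
    simp only [Finset.mem_insert, not_or] at hA
    rw [Finset.disjoint_insert_left] at hAB
    obtain ⟨p, q, hpq⟩ := Ideal.mem_span_pair.1
      (ih hA.2 hAB.2 fun w hw => hg w (Finset.mem_insert_of_mem hw))
    have h1 : diffProd b A * p ∈ Ideal.span {X b - X u, diffProd b B} := by
      obtain ⟨p', q', hpq'⟩ := Ideal.mem_span_pair.1 (hg u (Finset.mem_insert_self _ _))
      refine Ideal.mem_span_pair.2 ⟨p', q' - q, ?_⟩
      linear_combination hpq' - hpq
    obtain ⟨r, s, hrs⟩ := Ideal.mem_span_pair.1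
      (diffProd_mul_mem_span_pair hA.2 hB (Ne.symm hA.1) hu hAB.1 hAB.2 h1)
    refine Ideal.mem_span_pair.2 ⟨r, q + diffProd b A * s, ?_⟩
    have : diffProd b (insert u A) = (X b - X u) * diffProd b A := Finset.prod_insert hu
    rw [this]
    linear_combination hpq + diffProd b A * hrs

theorem exists_eq_diffProd_mul {b : V} {A B C : Finset V} (hA : b ∉ A) (hB : b ∉ B) (hC : b ∉ C)
    (hAB : Disjoint A B) (hAC : Disjoint A C) (hBC : Disjoint B C) {g : MvPolynomial V ℚ}
    (hg : ∀ c ∈ C, X b - X c ∣ g)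
    (hg' : ∀ u ∈ A, ∀ v ∈ B, g ∈ Ideal.span {X b - X u, X b - X v}) :
    ∃ s t, g = diffProd b C * (s * diffProd b A + t * diffProd b B) := by
  obtain ⟨g, rfl⟩ : diffProd b C ∣ g :=
    Finset.prod_dvd_of_isRelPrime (fun c hc d hd hcd => isRelPrime_X_sub_X
      (ne_of_mem_of_not_mem hc hC) (ne_of_mem_of_not_mem hd hC) hcd) hg
  obtain ⟨s, t, hst⟩ := Ideal.mem_span_pair.1 (mem_span_pair_diffProd_left hA hB hAB
    fun u hu => mem_span_pair_diffProd_right hB (ne_of_mem_of_not_mem hu hA)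
      (Finset.disjoint_left.1 hAB hu) fun v hv => by
        have hv1 : diffProd b {v} = X b - X v := by simp [diffProd]
        have := hg' u hu v hv
        rw [← hv1] at this ⊢
        exact diffProd_mul_mem_span_pair hC (by simpa using (ne_of_mem_of_not_mem hv hB).symm)
          (ne_of_mem_of_not_mem hu hA) (Finset.disjoint_left.1 hAC hu)
          (by simpa using (ne_of_mem_of_not_mem hv (Finset.disjoint_left.1 hAB hu)).symm)
          (by simpa using Finset.disjoint_left.1 hBC hv) this)
  exact ⟨s, t, by rw [hst]⟩

end SubstitutionOfVariables

section Splines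

variable {V : Type}

/-- The module `D(A(G))` in coordinates: tuples `θ` of polynomials such that `X i - X j` divides
`θ i - θ j` for every edge `{i, j}` of `G`. -/
noncomputable def splineModule (G : SimpleGraph V) :
    Submodule (MvPolynomial V ℚ) (V → MvPolynomial V ℚ) where
  carrier := {θ | ∀ i j, G.Adj i j → X i - X j ∣ θ i - θ j}
  add_mem' := by
    intro θ η hθ hη i j h
    rw [Pi.add_apply, Pi.add_apply, add_sub_add_comm]
    exact dvd_add (hθ i j h) (hη i j h)
  zero_mem' := by intro i j _; simp
  smul_mem' := by
    intro c θ hθ i j h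
    rw [Pi.smul_apply, Pi.smul_apply, ← smul_sub]
    exact (hθ i j h).mul_left c

theorem splineModule_anti {G G₀ : SimpleGraph V} (h : G₀ ≤ G) :
    splineModule G ≤ splineModule G₀ :=
  fun _ hθ i j hij => hθ i j (h hij)

theorem mem_splineModule_of_edge {G G₀ : SimpleGraph V} {a b : V}
    (hG : ∀ i j, G.Adj i j → G₀.Adj i j ∨ s(i, j) = s(a, b)) {θ : V → MvPolynomial V ℚ}
    (hθ : θ ∈ splineModule G₀) (hab : X a - X b ∣ θ a - θ b) : θ ∈ splineModule G := by
  intro i j hij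
  rcases hG i j hij with h | h
  · exact hθ i j h
  · rcases Sym2.eq_iff.1 h with ⟨rfl, rfl⟩ | ⟨rfl, rfl⟩
    · exact hab
    · rw [← neg_dvd, neg_sub, ← dvd_neg, neg_sub]
      exact hab

theorem splineModule_bot : splineModule (⊥ : SimpleGraph V) = ⊤ :=
  eq_top_iff.2 fun _ _ _ _ h => h.elim

theorem single_mem_splineModule [DecidableEq V] {G : SimpleGraph V} {a : V} {A : Finset V}
    (hA : ∀ c, c ∈ A ↔ G.Adj a c) : Pi.single a (diffProd a A) ∈ splineModule G := by
  intro i j hij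
  by_cases hi : i = a
  · subst hi
    rw [Pi.single_eq_same, Pi.single_eq_of_ne hij.ne', sub_zero]
    exact Finset.dvd_prod_of_mem _ ((hA j).2 hij)
  · by_cases hj : j = a
    · subst hj
      rw [Pi.single_eq_same, Pi.single_eq_of_ne hi, zero_sub, dvd_neg, ← neg_dvd, neg_sub]
      exact Finset.dvd_prod_of_mem _ ((hA i).2 hij.symm)
    · rw [Pi.single_eq_of_ne hi, Pi.single_eq_of_ne hj, sub_zero]
      exact dvd_zero _

theorem exists_substVar_eq [DecidableEq V] {G : SimpleGraph V} {a b : V} {A B C : Finset V}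
    (hA : ∀ u ∈ A, G.Adj a u) (hB : ∀ v ∈ B, G.Adj b v)
    (hC : ∀ c ∈ C, G.Adj a c ∧ G.Adj b c) (hAB : Disjoint A B) (hAC : Disjoint A C)
    (hBC : Disjoint B C) (hbA : b ∉ A) (haB : a ∉ B)
    (hab : a ≠ b) (hcomplete : ∀ u ∈ A, ∀ v ∈ B, G.Adj u v) {θ : V → MvPolynomial V ℚ}
    (hθ : θ ∈ splineModule G) :
    ∃ s t, substVar a b (θ a - θ b) =
      diffProd b C * (s * diffProd b A + t * diffProd b B) := by
  have haA : a ∉ A := fun h => (hA a h).ne rfl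
  have hbB : b ∉ B := fun h => (hB b h).ne rfl
  have haC : a ∉ C := fun h => (hC a h).1.ne rfl
  have hbC : b ∉ C := fun h => (hC b h).2.ne rfl
  refine exists_eq_diffProd_mul hbA hbB hbC hAB hAC hBC (fun c hc => ?_) fun u hu v hv => ?_
  · obtain ⟨p, hp⟩ := hθ a c (hC c hc).1
    obtain ⟨q, hq⟩ := hθ b c (hC c hc).2
    have hca : c ≠ a := ne_of_mem_of_not_mem hc haC
    have h : θ a - θ b = (X a - X c) * p - (X b - X c) * q := by linear_combination hp - hq
    rw [h, map_sub, map_mul, map_mul, map_sub, map_sub, substVar_X_self,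
      substVar_X_of_ne b hca, substVar_X_of_ne b hab.symm, ← mul_sub]
    exact dvd_mul_right _ _
  · obtain ⟨p, hp⟩ := hθ a u (hA u hu)
    obtain ⟨q, hq⟩ := hθ b v (hB v hv)
    obtain ⟨r, hr⟩ := hθ u v (hcomplete u hu v hv)
    have hua : u ≠ a := ne_of_mem_of_not_mem hu haA
    have hva : v ≠ a := ne_of_mem_of_not_mem hv haB
    have h : θ a - θ b = (X a - X u) * p + (X u - X v) * r - (X b - X v) * q := by
      linear_combination hp - hq + hr
    refine Ideal.mem_span_pair.2 ⟨substVar a b p - substVar a b r,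
      substVar a b r - substVar a b q, ?_⟩
    rw [h]
    simp only [map_sub, map_add, map_mul, substVar_X_self, substVar_X_of_ne b hua,
      substVar_X_of_ne b hva, substVar_X_of_ne b hab.symm]
    ring

/-- The syzygies of `f` and `g` modulo `p`. -/
noncomputable def syzygyMod {R : Type} [CommRing R] (p f g : R) : Submodule R (R × R) where
  carrier := {x | p ∣ x.1 * f + x.2 * g}
  add_mem' := by
    intro x y hx hy
    have : (x + y).1 * f + (x + y).2 * g = x.1 * f + x.2 * g + (y.1 * f + y.2 * g) := by
      simp only [Prod.fst_add, Prod.snd_add]; ring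
    exact (dvd_add hx hy).trans this.symm.dvd
  zero_mem' := by simp
  smul_mem' := by
    intro c x hx
    have : (c • x).1 * f + (c • x).2 * g = c * (x.1 * f + x.2 * g) := by
      simp only [Prod.smul_fst, Prod.smul_snd, smul_eq_mul]; ring
    exact (hx.mul_left c).trans this.symm.dvd

theorem mem_syzygyMod {R : Type} [CommRing R] {p f g : R} {x : R × R} :
    x ∈ syzygyMod p f g ↔ p ∣ x.1 * f + x.2 * g :=
  Iff.rfl

theorem pdLEOne_syzygyMod {R : Type} [CommRing R] [IsDomain R] {p f g q r : R} (hp : Prime p)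
    (hr : ¬ p ∣ r) (hrq : p ∣ r * f - q * g)
    (hgen : ∀ s t, p ∣ s * f + t * g → ∃ z, p ∣ s - z * r ∧ p ∣ t + z * q) :
    PdLEOne R (syzygyMod p f g) := by
  let φ : R →ₗ[R] R × R × R := (LinearMap.mulRight R r).prod
    ((LinearMap.mulRight R (-q)).prod (LinearMap.mulRight R (-p)))
  let ψ₀ : R × R × R →ₗ[R] R × R :=
    (LinearMap.coprod (LinearMap.mulRight R p)
      (LinearMap.coprod 0 (LinearMap.mulRight R r))).prod
    (LinearMap.coprod 0 (LinearMap.coprod (LinearMap.mulRight R p) (LinearMap.mulRight R (-q))))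
  have hφ : ∀ w, φ w = (w * r, w * -q, w * -p) := fun _ => rfl
  have hψ : ∀ x y z, ψ₀ (x, y, z) = (x * p + z * r, y * p + z * -q) := fun x y z => by
    simp [ψ₀]
  have hψ₀ : ∀ x, ψ₀ x ∈ syzygyMod p f g := by
    rintro ⟨x, y, z⟩
    obtain ⟨w, hw⟩ := hrq
    refine ⟨x * f + y * g + z * w, ?_⟩
    rw [hψ]
    linear_combination z * hw
  refine pdLEOne_of_presentation φ (ψ₀.codRestrict _ hψ₀) ?_ ?_ ?_
  · intro x y hxy
    have h := congrArg (fun x : R × R × R => x.2.2) hxy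
    exact mul_right_cancel₀ (neg_ne_zero.2 hp.ne_zero) h
  · rintro ⟨x, y, z⟩
    rw [← SetLike.coe_eq_coe, LinearMap.codRestrict_apply, hψ]
    simp only [ZeroMemClass.coe_zero, Set.mem_range, hφ, Prod.mk_eq_zero, Prod.mk.injEq]
    constructor
    · rintro ⟨h1, h2⟩
      obtain ⟨w, rfl⟩ : p ∣ z := (hp.dvd_or_dvd ⟨-x, by linear_combination h1⟩).resolve_right hr
      refine ⟨-w, ?_, ?_, by ring⟩
      · refine mul_right_cancel₀ hp.ne_zero ?_
        linear_combination -h1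
      · refine mul_right_cancel₀ hp.ne_zero ?_
        linear_combination -h2
    · rintro ⟨w, rfl, rfl, rfl⟩
      constructor <;> ring
  · rintro ⟨⟨s, t⟩, hst⟩
    obtain ⟨z, ⟨x, hx⟩, ⟨y, hy⟩⟩ := hgen s t hst
    refine ⟨(x, y, z), Subtype.ext ?_⟩
    rw [LinearMap.codRestrict_apply, hψ, Prod.mk.injEq]
    constructor
    · linear_combination -hx
    · linear_combination -hy

theorem PdLEOne.splineModule_of_edge [Fintype V] {G G₀ : SimpleGraph V} {a b : V}
    (hle : G₀ ≤ G) (hG : ∀ i j, G.Adj i j → G₀.Adj i j ∨ s(i, j) = s(a, b))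
    (hadj : G.Adj a b) (hnadj : ¬ G₀.Adj a b)
    (hcomplete : ∀ u v, G₀.Adj a u → ¬ G₀.Adj b u → G₀.Adj b v → ¬ G₀.Adj a v → G₀.Adj u v)
    (h : PdLEOne (MvPolynomial V ℚ) (splineModule G₀)) :
    PdLEOne (MvPolynomial V ℚ) (splineModule G) := by
  classical
  have hab := hadj.ne
  let Na : Finset V := Finset.univ.filter (G₀.Adj a)
  let Nb : Finset V := Finset.univ.filter (G₀.Adj b)
  let C := Na ∩ Nb
  let A := Na \ Nb
  let B := Nb \ Na
  have hNa : ∀ c, c ∈ Na ↔ G₀.Adj a c := fun c => by simp [Na]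
  have hNb : ∀ c, c ∈ Nb ↔ G₀.Adj b c := fun c => by simp [Nb]
  have hA : ∀ c, c ∈ A ↔ G₀.Adj a c ∧ ¬ G₀.Adj b c := fun c => by simp [A, hNa, hNb]
  have hB : ∀ c, c ∈ B ↔ G₀.Adj b c ∧ ¬ G₀.Adj a c := fun c => by simp [B, hNa, hNb]
  have hC : ∀ c, c ∈ C ↔ G₀.Adj a c ∧ G₀.Adj b c := fun c => by simp [C, hNa, hNb]
  have hAB : Disjoint A B := Finset.disjoint_left.2 fun c h1 h2 => ((hA c).1 h1).2 ((hB c).1 h2).1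
  have hAC : Disjoint A C := Finset.disjoint_left.2 fun c h1 h2 => ((hA c).1 h1).2 ((hC c).1 h2).2
  have hBC : Disjoint B C := Finset.disjoint_left.2 fun c h1 h2 => ((hB c).1 h1).2 ((hC c).1 h2).1
  have haNa : a ∉ Na := fun h => ((hNa a).1 h).ne rfl
  have haNb : a ∉ Nb := fun h => hnadj ((hNb a).1 h).symm
  have hbA : b ∉ A := fun h => hnadj ((hA b).1 h).1
  have haB : a ∉ B := fun h => haNb ((hNb a).2 ((hB a).1 h).1)
  have hbB : b ∉ B := fun h => ((hB b).1 h).1.ne rfl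
  have hbC : b ∉ C := fun h => ((hC b).1 h).2.ne rfl
  let f := diffProd a Na
  let g := diffProd b Nb
  have hf : substVar a b f = diffProd b C * diffProd b A := by
    rw [substVar_diffProd_left haNa]
    exact (Finset.prod_inter_mul_prod_sdiff Na Nb _).symm
  have hg : substVar a b g = diffProd b C * diffProd b B := by
    rw [substVar_diffProd haNb hab]
    have := (Finset.prod_inter_mul_prod_sdiff Nb Na fun c => (X b - X c : MvPolynomial V ℚ)).symm
    rwa [Finset.inter_comm] at this
  have hsA : substVar a b (diffProd b A) = diffProd b A :=
    substVar_diffProd (fun h => haNa ((hNa a).2 ((hA a).1 h).1)) hab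
  have hsB : substVar a b (diffProd b B) = diffProd b B := substVar_diffProd haB hab
  have hsC : substVar a b (diffProd b C) = diffProd b C :=
    substVar_diffProd (fun h => haNa ((hNa a).2 ((hC a).1 h).1)) hab
  have hfmem : Pi.single a f ∈ splineModule G₀ := single_mem_splineModule hNa
  have hgmem : Pi.single b g ∈ splineModule G₀ := single_mem_splineModule hNb
  have hK : PdLEOne (MvPolynomial V ℚ) (syzygyMod (X a - X b) f g) := by
    refine pdLEOne_syzygyMod (q := diffProd b A) (r := diffProd b B) (prime_X_sub_X hab) ?_ ?_ ?_
    · rw [X_sub_X_dvd_iff, hsB]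
      exact diffProd_ne_zero hbB
    · rw [X_sub_X_dvd_iff, map_sub, map_mul, map_mul, hf, hg, hsA, hsB]
      ring
    · intro s t hst
      rw [X_sub_X_dvd_iff, map_add, map_mul, map_mul, hf, hg] at hst
      have h1 : substVar a b s * diffProd b A + substVar a b t * diffProd b B = 0 := by
        refine mul_left_cancel₀ (diffProd_ne_zero hbC) ?_
        linear_combination hst
      obtain ⟨z, hz⟩ : diffProd b B ∣ substVar a b s :=
        (isRelPrime_diffProd hbB hbA hAB.symm).dvd_of_dvd_mul_right
          ⟨-substVar a b t, by linear_combination h1⟩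
      have hz' : substVar a b t = -z * diffProd b A := by
        refine mul_right_cancel₀ (diffProd_ne_zero hbB) ?_
        rw [hz] at h1
        linear_combination h1
      refine ⟨z, ?_, ?_⟩
      · convert X_sub_X_dvd_sub_substVar a b s using 1
        rw [hz]; ring
      · convert X_sub_X_dvd_sub_substVar a b t using 1
        rw [hz']; ring
  let ι := Submodule.inclusion (splineModule_anti hle)
  let κ : (MvPolynomial V ℚ × MvPolynomial V ℚ) →ₗ[MvPolynomial V ℚ] splineModule G₀ :=
    LinearMap.coprod (LinearMap.toSpanSingleton _ _ ⟨_, hfmem⟩)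
      (-LinearMap.toSpanSingleton _ _ ⟨_, hgmem⟩)
  have hκ : ∀ x, (κ x : V → MvPolynomial V ℚ) = x.1 • Pi.single a f - x.2 • Pi.single b g :=
    fun x => by simp [κ, sub_eq_add_neg]
  have hκab : ∀ x, (κ x : V → MvPolynomial V ℚ) a - (κ x : V → MvPolynomial V ℚ) b =
      x.1 * f + x.2 * g := fun x => by simp [hκ, hab, hab.symm]
  have hκmem : ∀ x : syzygyMod (X a - X b) f g, ((-κ x.1 : splineModule G₀) : V → _) ∈
      splineModule G := by
    intro x
    refine mem_splineModule_of_edge hG (-κ x.1).2 ?_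
    have := hκab x.1
    have hx : X a - X b ∣ x.1.1 * f + x.1.2 * g := x.2
    rw [← this] at hx
    convert (dvd_neg.2 hx) using 1
    simp only [NegMemClass.coe_neg, Pi.neg_apply]
    ring
  let j : syzygyMod (X a - X b) f g →ₗ[MvPolynomial V ℚ] splineModule G :=
    LinearMap.codRestrict _ ((splineModule G₀).subtype ∘ₗ (-κ) ∘ₗ Submodule.subtype _) hκmem
  refine PdLEOne.of_prod (N := MvPolynomial V ℚ × MvPolynomial V ℚ) ?_
  refine PdLEOne.middle (j.prod (Submodule.subtype _)) (ι.coprod κ) ?_ ?_ ?_ hK h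
  · intro x y hxy
    exact Subtype.ext (congrArg Prod.snd hxy)
  · rintro ⟨θ, x⟩
    rw [← SetLike.coe_eq_coe]
    constructor
    · intro hθ
      have hθ' : (θ : V → MvPolynomial V ℚ) = -(κ x : V → MvPolynomial V ℚ) :=
        eq_neg_of_add_eq_zero_left hθ
      have hx : x ∈ syzygyMod (X a - X b) f g := by
        rw [mem_syzygyMod, ← hκab, ← dvd_neg]
        have h := θ.2 a b hadj
        rw [hθ'] at h
        convert h using 1
        simp only [Pi.neg_apply]
        ring
      exact ⟨⟨x, hx⟩, Prod.ext (Subtype.ext hθ'.symm) rfl⟩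
    · rintro ⟨y, hy⟩
      obtain ⟨rfl, rfl⟩ := Prod.mk.inj hy
      exact neg_add_cancel (κ y.1 : V → MvPolynomial V ℚ)
  · intro θ
    obtain ⟨s, t, hst⟩ := exists_substVar_eq (fun u hu => ((hA u).1 hu).1)
      (fun v hv => ((hB v).1 hv).1) (fun c hc => (hC c).1 hc) hAB hAC hBC hbA haB hab
      (fun u hu v hv => hcomplete u v ((hA u).1 hu).1 ((hA u).1 hu).2 ((hB v).1 hv).1
        ((hB v).1 hv).2) θ.2
    have hmem : ((θ - κ (s, t) : splineModule G₀) : V → _) ∈ splineModule G := by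
      refine mem_splineModule_of_edge hG (θ - κ (s, t)).2 ?_
      have h0 : ((θ - κ (s, t) : splineModule G₀) : V → MvPolynomial V ℚ) a -
          ((θ - κ (s, t) : splineModule G₀) : V → MvPolynomial V ℚ) b =
          θ.1 a - θ.1 b - (s * f + t * g) := by
        rw [← hκab (s, t)]
        simp only [AddSubgroupClass.coe_sub, Pi.sub_apply]
        ring
      have h1 : substVar a b (substVar a b (θ.1 a - θ.1 b)) = substVar a b (θ.1 a - θ.1 b) :=
        substVar_substVar a b _
      rw [h0, X_sub_X_dvd_iff, map_sub, ← h1, hst]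
      simp only [map_mul, map_add, hf, hg, hsA, hsB, hsC]
      ring
    exact ⟨(⟨_, hmem⟩, (s, t)), Subtype.ext (sub_add_cancel _ _)⟩

end Splines

section LogarithmicDerivations

variable {ℓ : ℕ}

/-- A logarithmic derivation is determined by its values at the variables. -/
noncomputable def logDerEquiv (G : SimpleGraph (Fin ℓ)) :
    logDer ℓ G ≃ₗ[Spoly ℓ] splineModule G where
  toFun θ := ⟨fun i => θ.1 (X i), θ.2⟩
  invFun θ := ⟨mkDerivation ℚ θ.1, fun i j h => by
    rw [mkDerivation_X, mkDerivation_X]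
    exact θ.2 i j h⟩
  map_add' _ _ := rfl
  map_smul' _ _ := rfl
  left_inv θ := Subtype.ext (derivation_ext fun i => mkDerivation_X _ _ _)
  right_inv θ := Subtype.ext (funext fun i => mkDerivation_X _ _ _)

theorem pdLEOne_splineModule_bot (V : Type) [Fintype V] :
    PdLEOne (MvPolynomial V ℚ) (splineModule (⊥ : SimpleGraph V)) :=
  (pdLEOne_of_projective (R := MvPolynomial V ℚ) (M := V → MvPolynomial V ℚ)).of_equiv
    (Submodule.topEquiv.symm.trans (LinearEquiv.ofEq _ _ splineModule_bot.symm))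

end LogarithmicDerivations

section InducedPathsAndCycles

variable {V : Type} {G : SimpleGraph V}

/-- The vertices `p 0, …, p k` form an induced path of length `k`. -/
def IsIndPath (G : SimpleGraph V) (p : ℕ → V) (k : ℕ) : Prop :=
  ∀ i j, i < j → j ≤ k → p i ≠ p j ∧ (G.Adj (p i) (p j) ↔ j = i + 1)

/-- The vertices `f 0, …, f (n - 1)` form an induced cycle of length `n`. -/
def IsIndCycle (G : SimpleGraph V) (f : ℕ → V) (n : ℕ) : Prop :=
  ∀ i j, i < j → j < n → f i ≠ f j ∧ (G.Adj (f i) (f j) ↔ j = i + 1 ∨ (i = 0 ∧ j + 1 = n))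

theorem cycleGraph_adj_of_lt {n : ℕ} {i j : Fin n} (hij : i < j) :
    (SimpleGraph.cycleGraph n).Adj i j ↔
      j.val = i.val + 1 ∨ (i.val = 0 ∧ j.val + 1 = n) := by
  have h1 := i.2
  have h2 := j.2
  rw [SimpleGraph.cycleGraph_adj', Fin.coe_sub_iff_lt.2 hij, Fin.coe_sub_iff_le.2 hij.le]
  rw [Fin.lt_def] at hij
  omega

theorem IsIndCycle.hasInducedCycleLen {f : ℕ → V} {n : ℕ} (hf : IsIndCycle G f n) :
    HasInducedCycleLen G n := by
  have hinj : Function.Injective fun i : Fin n => f i := by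
    intro i j h
    rcases lt_trichotomy i j with hij | hij | hij
    · exact absurd h (hf i j hij j.2).1
    · exact hij
    · exact absurd h.symm (hf j i hij i.2).1
  refine ⟨Set.range fun i : Fin n => f i, ⟨SimpleGraph.Iso.symm ⟨Equiv.ofInjective _ hinj, ?_⟩⟩⟩
  intro i j
  change G.Adj (f i) (f j) ↔ _
  rcases lt_trichotomy i j with hij | rfl | hij
  · rw [(hf i j hij j.2).2, cycleGraph_adj_of_lt hij]
  · simp
  · rw [SimpleGraph.adj_comm, (hf j i hij i.2).2, SimpleGraph.adj_comm,
      cycleGraph_adj_of_lt hij]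

theorem HasInducedCycleLen.exists_isIndCycle {n : ℕ} (hn : 0 < n)
    (h : HasInducedCycleLen G n) :
    ∃ f, IsIndCycle G f n := by
  obtain ⟨s, ⟨e⟩⟩ := h
  let g : Fin n → V := fun i => (e.symm i).1
  have hg : ∀ i j, G.Adj (g i) (g j) ↔ (SimpleGraph.cycleGraph n).Adj i j := fun i j =>
    e.symm.map_adj_iff
  have hinj : Function.Injective g := fun i j hij => e.symm.injective (Subtype.ext hij)
  refine ⟨fun i => g ⟨i % n, Nat.mod_lt _ hn⟩, fun i j hij hj => ?_⟩
  simp only [Nat.mod_eq_of_lt hj, Nat.mod_eq_of_lt (hij.trans hj), hg]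
  exact ⟨fun h => hij.ne (congrArg Fin.val (hinj h)), cycleGraph_adj_of_lt hij⟩

theorem IsIndCycle.rotate {f : ℕ → V} {n c : ℕ} (hf : IsIndCycle G f n) (hc : c < n) :
    IsIndCycle G (fun i => f ((i + c) % n)) n := by
  have hmod : ∀ i, i < n → (i + c) % n = i + c ∧ i + c < n ∨
      (i + c) % n = i + c - n ∧ n ≤ i + c := by
    intro i hi
    rcases lt_or_ge (i + c) n with h | h
    · exact Or.inl ⟨Nat.mod_eq_of_lt h, h⟩
    · refine Or.inr ⟨?_, h⟩
      rw [Nat.mod_eq_sub_mod h, Nat.mod_eq_of_lt (by omega)]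
  intro i j hij hj
  have hlt := Nat.mod_lt (i + c) (show 0 < n by omega)
  have hlt' := Nat.mod_lt (j + c) (show 0 < n by omega)
  have h1 := hmod i (hij.trans hj)
  have h2 := hmod j hj
  simp only
  generalize (i + c) % n = i' at *
  generalize (j + c) % n = j' at *
  rcases lt_or_gt_of_ne (show i' ≠ j' by omega) with h | h
  · refine ⟨(hf i' j' h hlt').1, (hf i' j' h hlt').2.trans ?_⟩
    omega
  · rw [SimpleGraph.adj_comm]
    refine ⟨(hf j' i' h hlt).1.symm, (hf j' i' h hlt).2.trans ?_⟩
    omega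

theorem IsIndPath.mono {p : ℕ → V} {k m : ℕ} (hp : IsIndPath G p k) (h : m ≤ k) :
    IsIndPath G p m :=
  fun i j hij hj => hp i j hij (hj.trans h)

theorem IsIndPath.shift {p : ℕ → V} {k m c : ℕ} (hp : IsIndPath G p k) (h : c + m ≤ k) :
    IsIndPath G (fun i => p (c + i)) m := by
  intro i j hij hj
  refine ⟨(hp (c + i) (c + j) (by omega) (by omega)).1,
    (hp (c + i) (c + j) (by omega) (by omega)).2.trans ?_⟩
  omega

theorem IsIndPath.reverse {p : ℕ → V} {k : ℕ} (hp : IsIndPath G p k) :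
    IsIndPath G (fun i => p (k - i)) k := by
  intro i j hij hj
  rw [SimpleGraph.adj_comm]
  refine ⟨(hp (k - j) (k - i) (by omega) (by omega)).1.symm,
    (hp (k - j) (k - i) (by omega) (by omega)).2.trans ?_⟩
  omega

theorem IsIndPath.snoc {p : ℕ → V} {k : ℕ} {v : V} (hp : IsIndPath G p k)
    (hv : ∀ i ≤ k, p i ≠ v ∧ (G.Adj (p i) v ↔ i = k)) :
    IsIndPath G (fun i => if i ≤ k then p i else v) (k + 1) := by
  intro i j hij hj
  have hi : i ≤ k := by omega
  simp only [hi, if_true]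
  by_cases h : j ≤ k
  · simp only [h, if_true]
    exact hp i j hij h
  · simp only [h, if_false]
    refine ⟨(hv i hi).1, (hv i hi).2.trans ?_⟩
    omega

theorem IsIndPath.hasInducedCycleLen {p q : ℕ → V} {k m : ℕ} (hp : IsIndPath G p k)
    (hq : IsIndPath G q m)
    (h : ∀ i j, i ≤ k → j ≤ m →
      p i ≠ q j ∧ (G.Adj (p i) (q j) ↔ (i = k ∧ j = 0) ∨ (i = 0 ∧ j = m))) :
    HasInducedCycleLen G (k + m + 2) := by
  refine IsIndCycle.hasInducedCycleLen (f := fun i => if i ≤ k then p i else q (i - k - 1))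
    fun i j hij hj => ?_
  by_cases h2 : j ≤ k
  · have h1 : i ≤ k := by omega
    simp only [h1, h2, if_true]
    refine ⟨(hp i j hij h2).1, (hp i j hij h2).2.trans ?_⟩
    omega
  · by_cases h1 : i ≤ k
    · simp only [h1, h2, if_true, if_false]
      have := h i (j - k - 1) h1 (by omega)
      refine ⟨this.1, this.2.trans ?_⟩
      omega
    · simp only [h1, h2, if_false]
      have := hq (i - k - 1) (j - k - 1) (by omega) (by omega)
      refine ⟨this.1, this.2.trans ?_⟩
      omega

theorem IsIndPath.hasInducedCycleLen_of_vertex {p : ℕ → V} {k : ℕ} {v : V} (hp : IsIndPath G p k)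
    (hv : ∀ i ≤ k, p i ≠ v ∧ (G.Adj (p i) v ↔ i = 0 ∨ i = k)) :
    HasInducedCycleLen G (k + 2) := by
  refine hp.hasInducedCycleLen (q := fun _ => v) (m := 0) (fun i j _ _ => by omega)
    fun i j hi hj => ⟨(hv i hi).1, (hv i hi).2.trans ?_⟩
  omega

end InducedPathsAndCycles

section ConnectedSets

variable {V : Type} {G : SimpleGraph V}

/-- `u` and `v` are connected by a path with vertices in `U`. -/
def ReachableIn (G : SimpleGraph V) (U : Set V) : V → V → Prop :=
  Relation.ReflTransGen fun u v => G.Adj u v ∧ u ∈ U ∧ v ∈ U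

/-- Any two vertices of `U` are connected by a path with vertices in `U`. -/
def ConnectedOn (G : SimpleGraph V) (U : Set V) : Prop :=
  ∀ u ∈ U, ∀ v ∈ U, ReachableIn G U u v

/-- The sets `J` and `H` are disjoint and there are no edges between them. -/
def Anticomplete (G : SimpleGraph V) (J H : Set V) : Prop :=
  ∀ j ∈ J, ∀ h ∈ H, j ≠ h ∧ ¬ G.Adj j h

theorem Anticomplete.symm {J H : Set V} (h : Anticomplete G J H) : Anticomplete G H J :=
  fun x hx y hy => ⟨(h y hy x hx).1.symm, fun hadj => (h y hy x hx).2 hadj.symm⟩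

theorem ReachableIn.symm {U : Set V} {u v : V} (h : ReachableIn G U u v) : ReachableIn G U v u := by
  induction h with
  | refl => exact Relation.ReflTransGen.refl
  | tail _ h ih => exact ih.head ⟨h.1.symm, h.2.2, h.2.1⟩

theorem ReachableIn.mono {U U' : Set V} (hU : U ⊆ U') {u v : V} (h : ReachableIn G U u v) :
    ReachableIn G U' u v := by
  induction h with
  | refl => exact Relation.ReflTransGen.refl
  | tail _ h ih => exact ih.tail ⟨h.1, hU h.2.1, hU h.2.2⟩

theorem ReachableIn.mem {U : Set V} {u v : V} (hu : u ∈ U) (h : ReachableIn G U u v) : v ∈ U := by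
  rcases Relation.ReflTransGen.cases_tail h with h | ⟨w, _, h⟩
  · exact h ▸ hu
  · exact h.2.2

theorem connectedOn_reachableIn (U : Set V) (u : V) : ConnectedOn G {v | ReachableIn G U u v} := by
  have key : ∀ v, ReachableIn G U u v → ReachableIn G {v | ReachableIn G U u v} u v := by
    intro v hv
    induction hv with
    | refl => exact Relation.ReflTransGen.refl
    | tail h1 h2 ih => exact ih.tail ⟨h2.1, h1, h1.tail h2⟩
  exact fun v hv w hw => (key v hv).symm.trans (key w hw)

theorem connectedOn_singleton (v : V) : ConnectedOn G {v} := by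
  rintro u rfl w rfl
  exact Relation.ReflTransGen.refl

theorem ConnectedOn.insert_vertex {U : Set V} {u v : V} (hU : ConnectedOn G U) (hu : u ∈ U)
    (huv : G.Adj u v) : ConnectedOn G (insert v U) := by
  have key : ∀ w ∈ insert v U, ReachableIn G (insert v U) u w := by
    rintro w (rfl | hw)
    · exact Relation.ReflTransGen.single ⟨huv, Set.mem_insert_of_mem _ hu, Set.mem_insert _ _⟩
    · exact (hU u hu w hw).mono (Set.subset_insert _ _)
  exact fun w hw w' hw' => (key w hw).symm.trans (key w' hw')

theorem ReachableIn.exists_seq {U : Set V} {u v : V} (hu : u ∈ U) (h : ReachableIn G U u v) :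
    ∃ (p : ℕ → V) (k : ℕ), p 0 = u ∧ p k = v ∧ (∀ i < k, G.Adj (p i) (p (i + 1))) ∧
      ∀ i ≤ k, p i ∈ U := by
  induction h with
  | refl => exact ⟨fun _ => u, 0, rfl, rfl, fun i hi => by omega, fun _ _ => hu⟩
  | @tail x y h1 h2 ih =>
    obtain ⟨p, k, rfl, rfl, hadj, hmem⟩ := ih
    refine ⟨fun i => if i ≤ k then p i else y, k + 1, by simp, by simp, fun i hi => ?_,
      fun i _ => ?_⟩
    · have hi' : i ≤ k := by omega
      simp only [hi', if_true]
      split_ifs with h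
      · exact hadj i h
      · obtain rfl : i = k := by omega
        exact h2.1
    · simp only
      split_ifs with h
      · exact hmem i h
      · exact h2.2.2

theorem exists_isIndPath_of_seq {U : Set V} {p : ℕ → V} {k : ℕ} (hne : p 0 ≠ p k)
    (hadj : ∀ i < k, G.Adj (p i) (p (i + 1))) (hmem : ∀ i, 0 < i → i < k → p i ∈ U) :
    ∃ q m, IsIndPath G q m ∧ q 0 = p 0 ∧ q m = p k ∧ ∀ i, 0 < i → i < m → q i ∈ U := by
  induction k using Nat.strong_induction_on generalizing p with
  | _ k ih =>
    by_cases hp : IsIndPath G p k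
    · exact ⟨p, k, hp, rfl, rfl, hmem⟩
    · simp only [IsIndPath, not_forall] at hp
      obtain ⟨i, j, hij, hj, hbad⟩ := hp
      by_cases heq : p i = p j
      · have h0 : ¬ (i = 0 ∧ j = k) := by
          rintro ⟨rfl, rfl⟩
          exact hne heq
        let q : ℕ → V := fun n => if n < i then p n else p (n + (j - i))
        have hq0 : q 0 = p 0 := by
          by_cases hi : 0 < i
          · simp [q, hi]
          · obtain rfl : i = 0 := by omega
            simp [q, heq]
        have hqk : q (k - (j - i)) = p k := by
          have : ¬ k - (j - i) < i := by omega
          simp only [q, this, if_false]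
          congr 1
          omega
        have hr := ih (k - (j - i)) (by omega) (p := q) (by rwa [hq0, hqk])
          (fun n hn => ?_) (fun n hn hn' => ?_)
        · rwa [hq0, hqk] at hr
        · by_cases h1 : n < i
          · by_cases h2 : n + 1 < i
            · simpa only [q, h1, h2, if_true] using hadj n (by omega)
            · obtain rfl : i = n + 1 := by omega
              have h3 : n + 1 + (j - (n + 1)) = j := by omega
              simp only [q, h1, h2, if_true, if_false, h3, ← heq]
              exact hadj n (by omega)
          · have h2 : ¬ n + 1 < i := by omega
            simp only [q, h1, h2, if_false]
            have h3 : n + 1 + (j - i) = n + (j - i) + 1 := by omega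
            rw [h3]
            exact hadj _ (by omega)
        · simp only [q]
          split_ifs <;> exact hmem _ (by omega) (by omega)
      · have hb : G.Adj (p i) (p j) ∧ j ≠ i + 1 := by
          by_contra hb
          refine hbad ⟨heq, fun h => ?_, ?_⟩
          · by_contra h'
            exact hb ⟨h, h'⟩
          · rintro rfl
            exact hadj i (by omega)
        let q : ℕ → V := fun n => if n ≤ i then p n else p (n + (j - i - 1))
        have hq0 : q 0 = p 0 := by simp [q]
        have hqk : q (k - (j - i - 1)) = p k := by
          have : ¬ k - (j - i - 1) ≤ i := by omega
          simp only [q, this, if_false]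
          congr 1
          omega
        have hr := ih (k - (j - i - 1)) (by omega) (p := q) (by rwa [hq0, hqk])
          (fun n hn => ?_) (fun n hn hn' => ?_)
        · rwa [hq0, hqk] at hr
        · by_cases h1 : n ≤ i
          · by_cases h2 : n + 1 ≤ i
            · simpa only [q, h1, h2, if_true] using hadj n (by omega)
            · obtain rfl : i = n := by omega
              have h3 : i + 1 + (j - i - 1) = j := by omega
              simp only [q, h1, h2, if_true, if_false, h3]
              exact hb.1
          · have h2 : ¬ n + 1 ≤ i := by omega
            simp only [q, h1, h2, if_false]
            have h3 : n + 1 + (j - i - 1) = n + (j - i - 1) + 1 := by omega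
            rw [h3]
            exact hadj _ (by omega)
        · simp only [q]
          split_ifs <;> exact hmem _ (by omega) (by omega)

theorem ConnectedOn.exists_isIndPath {U : Set V} (hU : ConnectedOn G U) {a b u v : V}
    (hab : a ≠ b) (hu : u ∈ U) (hau : G.Adj a u) (hv : v ∈ U) (hbv : G.Adj b v) :
    ∃ q m, IsIndPath G q m ∧ q 0 = a ∧ q m = b ∧ ∀ i, 0 < i → i < m → q i ∈ U := by
  obtain ⟨p, k, rfl, rfl, hadj, hmem⟩ := (hU u hu v hv).exists_seq hu
  let q : ℕ → V := fun i => if i = 0 then a else if i ≤ k + 1 then p (i - 1) else b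
  have hq0 : q 0 = a := by simp [q]
  have hqk : q (k + 2) = b := by simp [q]
  have h := exists_isIndPath_of_seq (G := G) (U := U) (p := q) (k := k + 2) (by rwa [hq0, hqk])
    (fun i hi => ?_) (fun i hi hi' => ?_)
  · rwa [hq0, hqk] at h
  · rcases Nat.eq_zero_or_pos i with rfl | h0
    · simpa [q] using hau
    · have h1 : i ≠ 0 := by omega
      have h2 : i ≤ k + 1 := by omega
      have h3 : i = k + 1 ∨ i < k + 1 := by omega
      rcases h3 with rfl | h3
      · simpa [q] using hbv.symm
      · have h4 : i ≤ k := by omega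
        simp only [q, h1, h2, if_true, if_false, Nat.add_eq_zero_iff, one_ne_zero, and_false,
          Nat.add_le_add_iff_right, h4, Nat.add_sub_cancel]
        have := hadj (i - 1) (by omega)
        rwa [Nat.sub_add_cancel h0] at this
  · have h1 : i ≠ 0 := by omega
    have h2 : i ≤ k + 1 := by omega
    simp only [q, h1, h2, if_true, if_false]
    exact hmem _ (by omega)

end ConnectedSets

section CoPairs

variable {V : Type} {G : SimpleGraph V}

theorem WeaklyChordal.exists_common_neighbor_of_edge (hG : WeaklyChordal G) {J H : Set V}
    (hJ : ConnectedOn G J) (hH : ConnectedOn G H) (hJH : Anticomplete G J H) {a b : V}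
    (hab : a ≠ b) (hnadj : ¬ G.Adj a b) (haJ : ∃ j ∈ J, G.Adj a j) (hbJ : ∃ j ∈ J, G.Adj b j)
    (haH : ∃ h ∈ H, G.Adj a h) (hbH : ∃ h ∈ H, G.Adj b h) :
    ∃ j ∈ J, G.Adj a j ∧ G.Adj b j := by
  obtain ⟨u, hu, hau⟩ := haJ
  obtain ⟨v, hv, hbv⟩ := hbJ
  obtain ⟨u', hu', hau'⟩ := haH
  obtain ⟨v', hv', hbv'⟩ := hbH
  have haJ : a ∉ J := fun h => (hJH a h u' hu').2 hau'
  have hbJ : b ∉ J := fun h => (hJH b h v' hv').2 hbv'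
  have haH : a ∉ H := fun h => (hJH u hu a h).2 hau.symm
  have hbH : b ∉ H := fun h => (hJH v hv b h).2 hbv.symm
  obtain ⟨p, k, hp, hp0, hpk, hpJ⟩ := hJ.exists_isIndPath hab hu hau hv hbv
  obtain ⟨q, m, hq, hq0, hqm, hqH⟩ := hH.exists_isIndPath hab.symm hv' hbv' hu' hau'
  have two_le : ∀ {p : ℕ → V} {k : ℕ} {a b : V}, IsIndPath G p k → p 0 = a → p k = b → a ≠ b →
      ¬ G.Adj a b → 2 ≤ k := by
    rintro p k _ _ hp rfl rfl hab hnadj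
    by_contra hk
    interval_cases k
    · exact hab rfl
    · exact hnadj ((hp 0 1 (by omega) (by omega)).2.2 rfl)
  have hk := two_le hp hp0 hpk hab hnadj
  have hm := two_le hq hq0 hqm hab.symm (fun h => hnadj h.symm)
  obtain rfl | hk3 : k = 2 ∨ 3 ≤ k := by omega
  · refine ⟨p 1, hpJ 1 (by omega) (by omega), ?_, ?_⟩
    · rw [← hp0]
      exact (hp 0 1 (by omega) (by omega)).2.2 rfl
    · rw [← hpk]
      exact ((hp 1 2 (by omega) (by omega)).2.2 rfl).symm
  · refine absurd (hp.hasInducedCycleLen (hq.shift (c := 1) (m := m - 2) (by omega))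
      fun i j hi hj => ?_) (hG.1 (k + (m - 2) + 2) (by omega))
    have hqj : q (1 + j) ∈ H := hqH _ (by omega) (by omega)
    obtain h | h | h : i = 0 ∨ i = k ∨ (0 < i ∧ i < k) := by omega
    · rw [h, hp0]
      refine ⟨fun h => haH (h ▸ hqj), ?_⟩
      rw [← hqm, SimpleGraph.adj_comm, (hq (1 + j) m (by omega) le_rfl).2]
      omega
    · rw [h, hpk]
      refine ⟨fun h => hbH (h ▸ hqj), ?_⟩
      rw [← hq0, (hq 0 (1 + j) (by omega) (by omega)).2]
      omega
    · refine ⟨(hJH _ (hpJ i h.1 h.2) _ hqj).1,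
        iff_of_false (hJH _ (hpJ i h.1 h.2) _ hqj).2 (by omega)⟩

/-- In a weakly chordal graph, an induced path of the complement all of whose vertices have
neighbors in each of two anticomplete connected sets has a common neighbor in the first. -/
theorem WeaklyChordal.exists_common_neighbor (hG : WeaklyChordal G) {r : ℕ} {s : ℕ → V}
    {J H : Set V} (hJ : ConnectedOn G J) (hH : ConnectedOn G H) (hJH : Anticomplete G J H)
    (hs : IsIndPath Gᶜ s r) (hsJ : ∀ i ≤ r, ∃ j ∈ J, G.Adj (s i) j)
    (hsH : ∀ i ≤ r, ∃ h ∈ H, G.Adj (s i) h) : ∃ j ∈ J, ∀ i ≤ r, G.Adj (s i) j := by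
  induction r generalizing s J H with
  | zero =>
    obtain ⟨j, hj, hadj⟩ := hsJ 0 le_rfl
    exact ⟨j, hj, fun i hi => by rwa [Nat.le_zero.1 hi]⟩
  | succ r ih =>
    obtain rfl | hr : r = 0 ∨ 1 ≤ r := by omega
    · have h01 := (hs 0 1 (by omega) (by omega)).2.2 rfl
      rw [SimpleGraph.compl_adj] at h01
      obtain ⟨j, hj, h0, h1⟩ := hG.exists_common_neighbor_of_edge hJ hH hJH h01.1 h01.2
        (hsJ 0 (by omega)) (hsJ 1 (by omega)) (hsH 0 (by omega)) (hsH 1 (by omega))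
      refine ⟨j, hj, fun i hi => ?_⟩
      interval_cases i
      · exact h0
      · exact h1
    · by_contra! hcon
      have notMemJ : ∀ i ≤ r + 1, s i ∉ J := fun i hi h => by
        obtain ⟨x, hx, hadj⟩ := hsH i hi
        exact (hJH _ h x hx).2 hadj
      have notMemH : ∀ i ≤ r + 1, s i ∉ H := fun i hi h => by
        obtain ⟨x, hx, hadj⟩ := hsJ i hi
        exact (hJH x hx _ h).2 hadj.symm
      obtain ⟨j, hj, hsj⟩ := ih hJ hH hJH (hs.mono (by omega)) (fun i hi => hsJ i (by omega))
        (fun i hi => hsH i (by omega))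
      obtain ⟨q, hq, hsq⟩ := ih hJ hH hJH (hs.shift (c := 1) (by omega))
        (fun i hi => hsJ (1 + i) (by omega)) (fun i hi => hsH (1 + i) (by omega))
      obtain ⟨h, hh, hsh⟩ := ih hH hJ hJH.symm (hs.mono (by omega))
        (fun i hi => hsH i (by omega)) (fun i hi => hsJ i (by omega))
      have hjr : ¬ G.Adj (s (r + 1)) j := fun h' => by
        obtain ⟨i, hi, hi'⟩ := hcon j hj
        obtain rfl | hi : i = r + 1 ∨ i ≤ r := by omega
        · exact hi' h'
        · exact hi' (hsj i hi)
      have hq0 : ¬ G.Adj (s 0) q := fun h' => by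
        obtain ⟨i, hi, hi'⟩ := hcon q hq
        obtain rfl | hi : i = 0 ∨ 1 ≤ i := by omega
        · exact hi' h'
        · have := hsq (i - 1) (by omega)
          rw [Nat.add_sub_cancel' hi] at this
          exact hi' this
      have hsq' : ∀ i, 1 ≤ i → i ≤ r + 1 → G.Adj (s i) q := fun i h1 h2 => by
        have := hsq (i - 1) (by omega)
        rwa [Nat.add_sub_cancel' h1] at this
      have snocPath : ∀ v, (v ∈ J ∨ v ∈ H) → (∀ i ≤ r, G.Adj (s i) v) →
          ¬ G.Adj (s (r + 1)) v →
          IsIndPath Gᶜ (fun i => if i ≤ r + 1 then s i else v) (r + 2) := by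
        intro v hv h1 h2
        refine hs.snoc fun i hi => ?_
        have hne : s i ≠ v := by
          rintro rfl
          exact hv.elim (notMemJ i hi) (notMemH i hi)
        rw [SimpleGraph.compl_adj]
        refine ⟨hne, fun h' => ?_, ?_⟩
        · by_contra hir
          exact h'.2 (h1 i (by omega))
        · rintro rfl
          exact ⟨hne, h2⟩
      have notClosed : ∀ v, (v ∈ J ∨ v ∈ H) → (∀ i ≤ r, G.Adj (s i) v) →
          ¬ G.Adj (s (r + 1)) v → v ≠ q → G.Adj v q := by
        intro v hv h1 h2 hvq
        by_contra h3
        refine hG.2 (r + 2 + 2) (by omega) ((snocPath v hv h1 h2).hasInducedCycleLen_of_vertex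
          (v := q) fun i hi => ?_)
        by_cases hi' : i ≤ r + 1
        · have hne : s i ≠ q := by
            rintro rfl
            exact notMemJ i hi' hq
          simp only [hi', if_true]
          refine ⟨hne, ?_⟩
          rw [SimpleGraph.compl_adj]
          obtain rfl | h0 : i = 0 ∨ 1 ≤ i := by omega
          · exact iff_of_true ⟨hne, hq0⟩ (Or.inl rfl)
          · exact iff_of_false (fun h' => h'.2 (hsq' i h0 hi')) (by omega)
        · simp only [hi', if_false]
          refine ⟨hvq, iff_of_true ?_ (by omega)⟩
          rw [SimpleGraph.compl_adj]
          exact ⟨hvq, h3⟩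
      have hhr : G.Adj (s (r + 1)) h := by
        by_contra h'
        have hne := (hJH q hq h hh)
        exact hne.2 (notClosed h (Or.inr hh) hsh h' hne.1.symm).symm
      have hjq : j ≠ q := by
        rintro rfl
        exact hq0 (hsj 0 (by omega))
      have hadj := notClosed j (Or.inl hj) hsj hjr hjq
      have hpath : IsIndPath Gᶜ (fun i => if i ≤ r + 2 then
          (if i ≤ r + 1 then s i else j) else h) (r + 3) := by
        refine (snocPath j (Or.inl hj) hsj hjr).snoc fun i hi => ?_
        by_cases hi' : i ≤ r + 1
        · simp only [hi', if_true]
          refine ⟨fun h' => notMemH i hi' (h' ▸ hh), ?_⟩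
          rw [SimpleGraph.compl_adj]
          refine iff_of_false (fun h' => h'.2 ?_) (by omega)
          obtain rfl | h1 : i = r + 1 ∨ i ≤ r := by omega
          · exact hhr
          · exact hsh i h1
        · simp only [hi', if_false]
          refine ⟨(hJH j hj h hh).1, ?_⟩
          rw [SimpleGraph.compl_adj]
          exact iff_of_true (hJH j hj h hh) (by omega)
      refine hG.2 (r + 3 + 2) (by omega) (hpath.hasInducedCycleLen_of_vertex (v := q)
        fun i hi => ?_)
      obtain h1 | rfl | rfl : i ≤ r + 1 ∨ i = r + 2 ∨ i = r + 3 := by omega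
      · have h2 : i ≤ r + 2 := by omega
        have hne : s i ≠ q := by
          rintro rfl
          exact notMemJ i h1 hq
        simp only [h1, h2, if_true]
        refine ⟨hne, ?_⟩
        rw [SimpleGraph.compl_adj]
        obtain rfl | h0 : i = 0 ∨ 1 ≤ i := by omega
        · exact iff_of_true ⟨hne, hq0⟩ (Or.inl rfl)
        · exact iff_of_false (fun h' => h'.2 (hsq' i h0 h1)) (by omega)
      · have h1 : ¬ r + 2 ≤ r + 1 := by omega
        simp only [le_refl, h1, if_true, if_false]
        refine ⟨hjq, ?_⟩
        rw [SimpleGraph.compl_adj]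
        exact iff_of_false (fun h' => h'.2 hadj) (by omega)
      · have h1 : ¬ r + 3 ≤ r + 2 := by omega
        simp only [h1, if_false]
        refine ⟨(hJH q hq h hh).1.symm, iff_of_true ?_ (by simp)⟩
        rw [SimpleGraph.compl_adj]
        exact hJH.symm h hh q hq

/-- No induced path of the complement of length at least three which stays in `W` leads
from `x` to `y`. -/
def IsCoPairIn (G : SimpleGraph V) (W : Set V) (x y : V) : Prop :=
  ∀ p k, IsIndPath Gᶜ p k → 3 ≤ k → (∀ i ≤ k, p i ∈ W) → p 0 = x → p k ≠ y

theorem IsCoPairIn.symm {W : Set V} {x y : V} (h : IsCoPairIn G W x y) : IsCoPairIn G W y x :=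
  fun p k hp hk hW h0 hk' => h _ k hp.reverse hk (fun i _ => hW (k - i) (by omega))
    (by simpa using hk') (by simpa using h0)

theorem IsIndPath.adj_of_compl {p : ℕ → V} {k i j : ℕ} (hp : IsIndPath Gᶜ p k)
    (hij : i + 1 < j) (hj : j ≤ k) : G.Adj (p i) (p j) := by
  by_contra h
  have := (hp i j (by omega) hj).2.1 ((SimpleGraph.compl_adj _ _ _).2
    ⟨(hp i j (by omega) hj).1, h⟩)
  omega

theorem IsIndPath.not_adj_of_compl {p : ℕ → V} {k i : ℕ} (hp : IsIndPath Gᶜ p k)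
    (hi : i + 1 ≤ k) : ¬ G.Adj (p i) (p (i + 1)) :=
  ((SimpleGraph.compl_adj _ _ _).1 ((hp i (i + 1) (by omega) hi).2.2 rfl)).2

/-- `H` is a connected subset of `W` containing an edge, and is anticomplete to a nonempty
connected subset of `W` in which each vertex of `W` attached to `H` has a neighbor. -/
def IsPreHandle (G : SimpleGraph V) (W H : Set V) : Prop :=
  H ⊆ W ∧ ConnectedOn G H ∧ (∃ u ∈ H, ∃ v ∈ H, G.Adj u v) ∧
    ∃ J ⊆ W, J.Nonempty ∧ ConnectedOn G J ∧ Anticomplete G J H ∧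
      ∀ n ∈ W, n ∉ H → (∃ h ∈ H, G.Adj n h) → ∃ j ∈ J, G.Adj n j

theorem isPreHandle_reachableIn {W : Set V} {a b c : V} (ha : a ∈ W) (hb : b ∈ W) (hc : c ∈ W)
    (hab : G.Adj a b) (hac : a ≠ c) (hbc : b ≠ c) (hca : ¬ G.Adj c a) (hcb : ¬ G.Adj c b) :
    IsPreHandle G W {v | ReachableIn G {w ∈ W | w ≠ c ∧ ¬ G.Adj c w} a v} := by
  have haU : a ∈ {w ∈ W | w ≠ c ∧ ¬ G.Adj c w} := ⟨ha, hac, hca⟩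
  have hbU : b ∈ {w ∈ W | w ≠ c ∧ ¬ G.Adj c w} := ⟨hb, hbc, hcb⟩
  refine ⟨fun v hv => (ReachableIn.mem haU hv).1, connectedOn_reachableIn _ _,
    ⟨a, Relation.ReflTransGen.refl, b, Relation.ReflTransGen.single ⟨hab, haU, hbU⟩, hab⟩,
    {c}, Set.singleton_subset_iff.2 hc, Set.singleton_nonempty c, connectedOn_singleton c, ?_, ?_⟩
  · rintro _ rfl h hh
    have := ReachableIn.mem haU hh
    exact ⟨this.2.1.symm, this.2.2⟩
  · rintro n hn hnH ⟨h, hh, hadj⟩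
    refine ⟨c, rfl, ?_⟩
    by_contra hnc
    have hhU := ReachableIn.mem haU hh
    refine hnH (hh.tail ⟨hadj.symm, hhU, hn, ?_, fun h' => hnc h'.symm⟩)
    rintro rfl
    exact hhU.2.2 hadj

/-- In a minimal such set `H`, the neighbors of an attached vertex cover all edges of `H`. -/
theorem IsPreHandle.adj_or_adj_of_minimal {W H : Set V} (hH : IsPreHandle G W H)
    (hmin : ∀ H' ⊂ H, ¬ IsPreHandle G W H') {n u v : V} (hn : n ∈ W) (hnH : n ∉ H)
    (hnadj : ∃ h ∈ H, G.Adj n h) (hu : u ∈ H) (hv : v ∈ H) (huv : G.Adj u v) :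
    G.Adj n u ∨ G.Adj n v := by
  by_contra! hcon
  obtain ⟨hHW, -, -, J, hJW, -, hJ, hJH, hNJ⟩ := hH
  have huU : u ∈ {w ∈ H | ¬ G.Adj n w} := ⟨hu, hcon.1⟩
  have hvU : v ∈ {w ∈ H | ¬ G.Adj n w} := ⟨hv, hcon.2⟩
  have hmem : ∀ w, ReachableIn G {w ∈ H | ¬ G.Adj n w} u w → w ∈ H ∧ ¬ G.Adj n w :=
    fun w hw => ReachableIn.mem (U := {w ∈ H | ¬ G.Adj n w}) huU hw
  refine hmin {w | ReachableIn G {w ∈ H | ¬ G.Adj n w} u w} ⟨fun w hw => (hmem w hw).1, ?_⟩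
    ⟨fun w hw => hHW (hmem w hw).1, connectedOn_reachableIn _ _,
      ⟨u, Relation.ReflTransGen.refl, v, Relation.ReflTransGen.single ⟨huv, huU, hvU⟩, huv⟩,
      insert n J, Set.insert_subset hn hJW, Set.insert_nonempty _ _, ?_, ?_, ?_⟩
  · obtain ⟨h, hh, hnh⟩ := hnadj
    exact fun hsub => (hmem h (hsub hh)).2 hnh
  · obtain ⟨j, hj, hnj⟩ := hNJ n hn hnH hnadj
    exact hJ.insert_vertex hj hnj.symm
  · rintro j (rfl | hj) h hh
    · exact ⟨fun h' => hnH (h' ▸ (hmem h hh).1), (hmem h hh).2⟩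
    · exact hJH j hj h (hmem h hh).1
  · rintro m hm hmH ⟨h, hh, hmh⟩
    by_cases hmH' : m ∈ H
    · refine ⟨n, Set.mem_insert _ _, ?_⟩
      by_contra hmn
      exact hmH (hh.tail ⟨hmh.symm, hmem h hh, hmH', fun h' => hmn h'.symm⟩)
    · obtain ⟨j, hj, hmj⟩ := hNJ m hm hmH' ⟨h, (hmem h hh).1, hmh⟩
      exact ⟨j, Set.mem_insert_of_mem _ hj, hmj⟩

theorem IsPreHandle.isCoPairIn_of_minimal {W H : Set V} (hG : WeaklyChordal G)
    (hH : IsPreHandle G W H) (hmin : ∀ H' ⊂ H, ¬ IsPreHandle G W H') {x y : V} (hx : x ∈ H)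
    (hy : y ∈ H) (hxy : IsCoPairIn G H x y) : IsCoPairIn G W x y := by
  intro p k hp hk hpW hp0 hpk
  by_cases hall : ∀ i ≤ k, p i ∈ H
  · exact hxy p k hp hk hall hp0 hpk
  push Not at hall
  obtain ⟨i, hi, hiH⟩ := hall
  have hcover := fun n u v => hH.adj_or_adj_of_minimal hmin (n := n) (u := u) (v := v)
  obtain ⟨hHW, hHc, -, J, hJW, -, hJ, hJH, hNJ⟩ := hH
  have hN : ∀ i ≤ k, ∃ h ∈ H, G.Adj (p i) h := by
    intro i hi
    obtain h | h : 2 ≤ i ∨ i + 1 < k := by omega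
    · exact ⟨x, hx, hp0 ▸ (hp.adj_of_compl (by omega) hi).symm⟩
    · exact ⟨y, hy, hpk ▸ hp.adj_of_compl h le_rfl⟩
  obtain ⟨a, hai, haH, hamax⟩ : ∃ a < i, p a ∈ H ∧ ∀ m, a < m → m ≤ i → p m ∉ H := by
    classical
    have h0 : p 0 ∈ H := hp0 ▸ hx
    refine ⟨Nat.findGreatest (fun m => p m ∈ H) i, ?_,
      Nat.findGreatest_spec (P := fun m => p m ∈ H) (Nat.zero_le i) h0,
      fun m hm hmi => Nat.findGreatest_is_greatest hm hmi⟩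
    refine (Nat.findGreatest_le i).lt_of_ne fun h => hiH ?_
    have := Nat.findGreatest_spec (P := fun m => p m ∈ H) (Nat.zero_le i) h0
    rwa [h] at this
  obtain ⟨b, hib, hbk, hbH, hbmin⟩ : ∃ b, i < b ∧ b ≤ k ∧ p b ∈ H ∧
      ∀ m, i ≤ m → m < b → p m ∉ H := by
    classical
    have hex : ∃ m, i ≤ m ∧ p m ∈ H := ⟨k, hi, hpk ▸ hy⟩
    have hspec := Nat.find_spec hex
    refine ⟨Nat.find hex, hspec.1.lt_of_ne fun h => hiH ?_, Nat.find_le ⟨hi, hpk ▸ hy⟩, hspec.2,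
      fun m hm hmb hmH => Nat.find_min hex hmb ⟨hm, hmH⟩⟩
    have := hspec.2
    rwa [← h] at this
  have hrun : ∀ m, a < m → m < b → p m ∉ H := fun m h1 h2 => by
    rcases le_total m i with h | h
    · exact hamax m h1 h
    · exact hbmin m h h2
  obtain h2 | h3 : b = a + 2 ∨ a + 3 ≤ b := by omega
  · subst h2
    rcases hcover (p (a + 1)) (p a) (p (a + 2)) (hpW _ (by omega))
      (hrun _ (by omega) (by omega)) (hN _ (by omega)) haH hbH
      (hp.adj_of_compl (by omega) hbk) with h | h
    · exact hp.not_adj_of_compl (by omega) h.symm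
    · exact hp.not_adj_of_compl (by omega) h
  · obtain ⟨j, hj, hjrun⟩ := hG.exists_common_neighbor hJ hHc hJH
      (hp.shift (c := a + 1) (m := b - a - 2) (by omega))
      (fun m hm => hNJ _ (hpW _ (by omega)) (hrun _ (by omega) (by omega)) (hN _ (by omega)))
      (fun m hm => hN _ (by omega))
    refine hG.2 (b - a + 2) (by omega) ((hp.shift (c := a) (m := b - a)
      (by omega)).hasInducedCycleLen_of_vertex (v := j) fun m hm => ?_)
    rw [SimpleGraph.compl_adj]
    by_cases hmab : m = 0 ∨ m = b - a
    · have hmH : p (a + m) ∈ H := by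
        rcases hmab with rfl | rfl
        · exact haH
        · rwa [Nat.add_sub_cancel' (by omega)]
      have := hJH.symm _ hmH j hj
      exact ⟨this.1, iff_of_true this hmab⟩
    · have := hjrun (m - 1) (by omega)
      rw [show a + 1 + (m - 1) = a + m by omega] at this
      exact ⟨this.ne, iff_of_false (fun h => h.2 this) hmab⟩

theorem WeaklyChordal.exists_isCoPairIn [Finite V] (hG : WeaklyChordal G) (W : Set V)
    (hW : ∃ a ∈ W, ∃ b ∈ W, G.Adj a b) :
    ∃ x ∈ W, ∃ y ∈ W, G.Adj x y ∧ IsCoPairIn G W x y := by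
  induction W using WellFoundedLT.induction with
  | _ W ih =>
  by_cases hc : ∃ a ∈ W, ∃ b ∈ W, ∃ c ∈ W, G.Adj a b ∧ a ≠ c ∧ b ≠ c ∧ ¬ G.Adj c a ∧ ¬ G.Adj c b
  · obtain ⟨a, ha, b, hb, c, hc, hab, hac, hbc, hca, hcb⟩ := hc
    obtain ⟨H, hH, hmin⟩ := wellFounded_lt.has_min {H | IsPreHandle G W H}
      ⟨_, isPreHandle_reachableIn ha hb hc hab hac hbc hca hcb⟩
    have hmin' : ∀ H' ⊂ H, ¬ IsPreHandle G W H' := fun H' h h' => hmin H' h' h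
    obtain ⟨hHW, -, hedge, J, hJW, ⟨j, hj⟩, -, hJH, -⟩ := id hH
    have hlt : H < W := ⟨hHW, fun h => (hJH j hj j (h (hJW hj))).1 rfl⟩
    obtain ⟨x, hx, y, hy, hxy, hpair⟩ := ih H hlt hedge
    exact ⟨x, hHW hx, y, hHW hy, hxy, hH.isCoPairIn_of_minimal hG hmin' hx hy hpair⟩
  · obtain ⟨a, ha, b, hb, hab⟩ := hW
    refine ⟨a, ha, b, hb, hab, fun p k hp hk hpW _ _ => hc ⟨p 0, hpW 0 (by omega), p 2,
      hpW 2 (by omega), p 1, hpW 1 (by omega), ?_, ?_, ?_, ?_, ?_⟩⟩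
    · exact hp.adj_of_compl (by omega) (by omega)
    · exact (hp 0 1 (by omega) (by omega)).1
    · exact (hp 1 2 (by omega) (by omega)).1.symm
    · exact fun h => hp.not_adj_of_compl (i := 0) (by omega) h.symm
    · exact hp.not_adj_of_compl (i := 1) (by omega)

theorem isIndPath_of_four {a b c d : V} (hab : G.Adj a b) (hbc : G.Adj b c) (hcd : G.Adj c d)
    (hac : a ≠ c ∧ ¬ G.Adj a c) (hbd : b ≠ d ∧ ¬ G.Adj b d) (had : a ≠ d ∧ ¬ G.Adj a d) :
    IsIndPath G (fun i => if i = 0 then a else if i = 1 then b else if i = 2 then c else d) 3 := by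
  intro i j hij hj
  interval_cases j <;> interval_cases i <;>
    simp [hab, hab.ne, hbc, hbc.ne, hcd, hcd.ne, hac, hbd, had]

theorem IsCoPairIn.adj_of_adj {x y u v : V} (h : IsCoPairIn G Set.univ x y) (hxy : G.Adj x y)
    (hxu : G.Adj x u) (hyu : ¬ G.Adj y u) (huy : u ≠ y) (hyv : G.Adj y v) (hxv : ¬ G.Adj x v)
    (hvx : v ≠ x) : G.Adj u v := by
  by_contra huv
  have hne : v ≠ u := fun h' => hyu (h' ▸ hyv)
  refine h _ 3 (isIndPath_of_four (a := x) (b := v) (c := u) (d := y) ?_ ?_ ?_ ?_ ?_ ?_) le_rfl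
    (fun _ _ => Set.mem_univ _) rfl rfl
  · exact (SimpleGraph.compl_adj _ _ _).2 ⟨hvx.symm, hxv⟩
  · exact (SimpleGraph.compl_adj _ _ _).2 ⟨hne, fun h => huv h.symm⟩
  · exact (SimpleGraph.compl_adj _ _ _).2 ⟨huy, fun h => hyu h.symm⟩
  · exact ⟨hxu.ne, fun h => ((SimpleGraph.compl_adj _ _ _).1 h).2 hxu⟩
  · exact ⟨hyv.ne', fun h => ((SimpleGraph.compl_adj _ _ _).1 h).2 hyv.symm⟩
  · exact ⟨hxy.ne, fun h => ((SimpleGraph.compl_adj _ _ _).1 h).2 hxy⟩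

/-- No induced cycle of length at least five in `G` minus the edge `xy` passes through both
`x` and `y`. -/
theorem IsCoPairIn.not_isIndCycle {x y : V} (h : IsCoPairIn G Set.univ x y) (hxy : G.Adj x y)
    {f : ℕ → V} {n j : ℕ} (hn : 5 ≤ n) (hj3 : 3 ≤ j) (hj : j + 2 ≤ n) (h0 : f 0 = x)
    (hfj : f j = y) :
    ¬ IsIndCycle (G.deleteEdges {s(x, y)}) f n := by
  intro hf
  have hne : ∀ i m, i < n → m < n → i ≠ m → f i ≠ f m := by
    intro i m hi hm him
    rcases lt_or_gt_of_ne him with h | h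
    · exact (hf i m h hm).1
    · exact (hf m i h hi).1.symm
  have hadj : ∀ i m, i < m → m < n → ¬ (i = 0 ∧ m = j) →
      (Gᶜ.Adj (f i) (f m) ↔ ¬ (m = i + 1 ∨ (i = 0 ∧ m + 1 = n))) := by
    intro i m him hm hij
    rw [← (hf i m him hm).2, SimpleGraph.compl_adj, SimpleGraph.deleteEdges_adj]
    have : s(f i, f m) ∉ ({s(x, y)} : Set (Sym2 V)) := by
      rw [Set.mem_singleton_iff, Sym2.eq_iff, ← h0, ← hfj]
      rintro (⟨h1, h2⟩ | ⟨h1, h2⟩)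
      · refine hij ⟨?_, ?_⟩
        · by_contra h'
          exact hne i 0 (by omega) (by omega) h' h1
        · by_contra h'
          exact hne m j (by omega) (by omega) h' h2
      · exact hne m 0 (by omega) (by omega) (by omega) h2
    simp [this, (hf i m him hm).1]
  have hxy' : ¬ Gᶜ.Adj (f 0) (f j) := by
    rw [h0, hfj, SimpleGraph.compl_adj]
    exact fun h => h.2 hxy
  obtain h5 | ⟨m, hm2, hmn, hmj, hjm⟩ : (n = 5 ∧ j = 3) ∨
      ∃ m, 2 < m ∧ m + 1 < n ∧ m ≠ j ∧ (m = j + 1 ∨ j = m + 1) := by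
    by_cases h5 : n = 5
    · exact Or.inl (by omega)
    · by_cases h4 : j = 3
      · exact Or.inr ⟨4, by omega⟩
      · exact Or.inr ⟨j - 1, by omega⟩
  · obtain ⟨rfl, rfl⟩ := h5
    refine h (fun i => f (2 * i % 5)) 4 ?_ (by omega) (fun _ _ => Set.mem_univ _) h0
      (by simpa using hfj)
    intro i m him hm
    refine ⟨hne _ _ (by omega) (by omega) (by omega), ?_⟩
    have hd : ∀ i m, i < m → m < 5 → ¬ (i = 0 ∧ m = 3) → ¬ (m = i + 1 ∨ i = 0 ∧ m + 1 = 5) →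
        Gᶜ.Adj (f i) (f m) := fun i m h1 h2 h3 h4 => (hadj i m h1 h2 h3).2 h4
    have hc : ∀ i m, i < m → m < 5 → (m = i + 1 ∨ i = 0 ∧ m + 1 = 5) → ¬ Gᶜ.Adj (f i) (f m) :=
      fun i m h1 h2 h3 h4 => (hadj i m h1 h2 (by omega)).1 h4 h3
    interval_cases m <;> interval_cases i
    · exact iff_of_true (hd 0 2 (by omega) (by omega) (by omega) (by omega)) rfl
    · exact iff_of_false (hc 0 4 (by omega) (by omega) (by omega)) (by omega)
    · exact iff_of_true (hd 2 4 (by omega) (by omega) (by omega) (by omega)) rfl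
    · exact iff_of_false (hc 0 1 (by omega) (by omega) (by omega)) (by omega)
    · exact iff_of_false (fun h => hc 1 2 (by omega) (by omega) (by omega) h.symm) (by omega)
    · exact iff_of_true (hd 1 4 (by omega) (by omega) (by omega) (by omega)).symm rfl
    · exact iff_of_false hxy' (by omega)
    · exact iff_of_false (hc 2 3 (by omega) (by omega) (by omega)) (by omega)
    · exact iff_of_false (fun h => hc 3 4 (by omega) (by omega) (by omega) h.symm) (by omega)
    · exact iff_of_true (hd 1 3 (by omega) (by omega) (by omega) (by omega)) rfl
  · refine h _ 3 (isIndPath_of_four (a := f 0) (b := f m) (c := f 1) (d := f j)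
      ?_ ?_ ?_ ?_ ?_ ?_) le_rfl (fun _ _ => Set.mem_univ _) h0 hfj
    · rw [hadj _ _ (by omega) (by omega) (by omega)]
      omega
    · rw [SimpleGraph.adj_comm, hadj _ _ (by omega) (by omega) (by omega)]
      omega
    · rw [hadj _ _ (by omega) (by omega) (by omega)]
      omega
    · refine ⟨hne _ _ (by omega) (by omega) (by omega), ?_⟩
      rw [hadj _ _ (by omega) (by omega) (by omega)]
      omega
    · refine ⟨hne _ _ (by omega) (by omega) (by omega), ?_⟩
      rcases hjm.symm with rfl | rfl
      · rw [hadj _ _ (by omega) (by omega) (by omega)]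
        omega
      · rw [SimpleGraph.adj_comm, hadj _ _ (by omega) (by omega) (by omega)]
        omega
    · exact ⟨hne _ _ (by omega) (by omega) (by omega), hxy'⟩

theorem IsIndCycle.congr {G' : SimpleGraph V} {f : ℕ → V} {n : ℕ} (hf : IsIndCycle G f n)
    (h : ∀ i j, i < n → j < n → (G'.Adj (f i) (f j) ↔ G.Adj (f i) (f j))) :
    IsIndCycle G' f n :=
  fun i j hij hj => ⟨(hf i j hij hj).1, (h i j (hij.trans hj) hj).trans (hf i j hij hj).2⟩

theorem IsIndCycle.exists_rotate {f : ℕ → V} {n j : ℕ} (hf : IsIndCycle G f n) (hj : j < n) :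
    ∃ g, IsIndCycle G g n ∧ g 0 = f j ∧ ∀ i < n, ∃ m < n, g m = f i := by
  refine ⟨_, hf.rotate hj, by simp [Nat.mod_eq_of_lt hj], fun i hi => ?_⟩
  rcases lt_or_ge i j with h | h
  · refine ⟨i + n - j, by omega, ?_⟩
    rw [show i + n - j + j = i + n by omega, Nat.add_mod_right, Nat.mod_eq_of_lt hi]
  · refine ⟨i - j, by omega, ?_⟩
    rw [Nat.sub_add_cancel h, Nat.mod_eq_of_lt hi]

/-- If `G` has no induced cycle of length `n` and `G'` agrees with `G` off one pair `x`, `y`, then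
an induced cycle of length `n` of `G'` passes through both `x` and `y`. -/
theorem exists_isIndCycle_through {G' : SimpleGraph V} {x y : V} {n : ℕ} (hn : 0 < n)
    (hG : ¬ HasInducedCycleLen G n) (hG' : HasInducedCycleLen G' n)
    (h : ∀ u v, s(u, v) ≠ s(x, y) → (G'.Adj u v ↔ G.Adj u v)) :
    ∃ f, IsIndCycle G' f n ∧ f 0 = x ∧ ∃ j < n, f j = y := by
  obtain ⟨f, hf⟩ := hG'.exists_isIndCycle hn
  by_cases hxy : (∃ i < n, f i = x) ∧ ∃ j < n, f j = y
  · obtain ⟨⟨i, hi, hix⟩, j, hj, hjy⟩ := hxy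
    obtain ⟨g, hg, hg0, hgs⟩ := hf.exists_rotate hi
    obtain ⟨m, hm, hgm⟩ := hgs j hj
    exact ⟨g, hg, hg0.trans hix, m, hm, hgm.trans hjy⟩
  · refine absurd (hf.congr fun i j hi hj =>
      (h _ _ fun hij => hxy ?_).symm : IsIndCycle G f n).hasInducedCycleLen hG
    rcases Sym2.eq_iff.1 hij with ⟨h1, h2⟩ | ⟨h1, h2⟩
    · exact ⟨⟨i, hi, h1⟩, j, hj, h2⟩
    · exact ⟨⟨j, hj, h2⟩, i, hi, h1⟩

theorem WeaklyChordal.deleteEdges (hG : WeaklyChordal G) {x y : V} (hxy : G.Adj x y)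
    (h : IsCoPairIn G Set.univ x y) : WeaklyChordal (G.deleteEdges {s(x, y)}) := by
  have hagree : ∀ u v, s(u, v) ≠ s(x, y) → ((G.deleteEdges {s(x, y)}).Adj u v ↔ G.Adj u v) :=
    fun u v huv => by simp [SimpleGraph.deleteEdges_adj, huv]
  have hagree' : ∀ u v, s(u, v) ≠ s(x, y) →
      ((G.deleteEdges {s(x, y)})ᶜ.Adj u v ↔ Gᶜ.Adj u v) := fun u v huv => by
    rw [SimpleGraph.compl_adj, SimpleGraph.compl_adj, hagree u v huv]
  constructor
  · intro n hn hcyc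
    obtain ⟨f, hf, h0, j, hj, hfj⟩ := exists_isIndCycle_through (by omega) (hG.1 n hn) hcyc hagree
    have hj0 : 0 < j := Nat.pos_of_ne_zero (by rintro rfl; exact hxy.ne (h0.symm.trans hfj))
    have hnadj : ¬ (G.deleteEdges {s(x, y)}).Adj (f 0) (f j) := by
      simp [SimpleGraph.deleteEdges_adj, h0, hfj]
    rw [(hf 0 j hj0 hj).2] at hnadj
    by_cases hj3 : 3 ≤ j
    · exact h.not_isIndCycle hxy hn hj3 (by omega) h0 hfj hf
    · refine h.symm.not_isIndCycle hxy.symm hn (j := n - j) (by omega) (by omega) ?_ ?_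
        (Sym2.eq_swap (a := x) (b := y) ▸ hf.rotate hj)
      · simpa [Nat.mod_eq_of_lt hj] using hfj
      · simpa [Nat.sub_add_cancel hj.le] using h0
  · intro n hn hcyc
    obtain ⟨f, hf, h0, j, hj, hfj⟩ :=
      exists_isIndCycle_through (by omega) (hG.2 n hn) hcyc hagree'
    have hj0 : 0 < j := Nat.pos_of_ne_zero (by rintro rfl; exact hxy.ne (h0.symm.trans hfj))
    have hadj : (G.deleteEdges {s(x, y)})ᶜ.Adj (f 0) (f j) := by
      simp [SimpleGraph.compl_adj, SimpleGraph.deleteEdges_adj, h0, hfj, hxy.ne]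
    rw [(hf 0 j hj0 hj).2] at hadj
    have key : ∀ {g : ℕ → V}, IsIndCycle (G.deleteEdges {s(x, y)})ᶜ g n →
        s(g 0, g (n - 1)) = s(x, y) → IsIndPath Gᶜ g (n - 1) := by
      intro g hg hg0 i m him hm
      have hg' := hg i m him (by omega)
      refine ⟨hg'.1, ?_⟩
      by_cases hin : i = 0 ∧ m = n - 1
      · obtain ⟨rfl, rfl⟩ := hin
        refine iff_of_false (fun hadj => ?_) (by omega)
        rw [← SimpleGraph.mem_edgeSet, hg0, SimpleGraph.mem_edgeSet,
          SimpleGraph.compl_adj] at hadj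
        exact hadj.2 hxy
      · rw [← hagree', hg'.2]
        · omega
        · rw [← hg0, Ne, Sym2.eq_iff]
          have hinj : ∀ a b, a < b → b < n → g a ≠ g b := fun a b hab hb => (hg a b hab hb).1
          rintro (⟨h1, h2⟩ | ⟨h1, h2⟩)
          · refine hin ⟨?_, ?_⟩
            · by_contra hi
              exact hinj 0 i (by omega) (by omega) h1.symm
            · by_contra hi
              exact hinj m (n - 1) (by omega) (by omega) h2
          · exact hinj 0 m (by omega) (by omega) h2.symm
    obtain rfl | hjn : j = 1 ∨ j = n - 1 := by omega
    · have h0' : f ((0 + 1) % n) = y := by rwa [Nat.mod_eq_of_lt (by omega)]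
      have h1' : f ((n - 1 + 1) % n) = x := by
        rwa [Nat.sub_add_cancel (by omega), Nat.mod_self]
      exact h.symm _ (n - 1) (key (hf.rotate hj) (by rw [h0', h1', Sym2.eq_swap])) (by omega)
        (fun _ _ => Set.mem_univ _) h0' h1'
    · subst hjn
      exact h f (n - 1) (key hf (by rw [h0, hfj])) (by omega) (fun _ _ => Set.mem_univ _) h0 hfj

theorem WeaklyChordal.pdLEOne_splineModule [Fintype V] (hG : WeaklyChordal G) :
    PdLEOne (MvPolynomial V ℚ) (splineModule G) := by
  induction G using WellFoundedLT.induction with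
  | _ G ih =>
  by_cases hbot : G = ⊥
  · exact hbot ▸ pdLEOne_splineModule_bot V
  · obtain ⟨a, b, hab⟩ := SimpleGraph.ne_bot_iff_exists_adj.1 hbot
    obtain ⟨x, -, y, -, hxy, hpair⟩ := hG.exists_isCoPairIn Set.univ
      ⟨a, Set.mem_univ a, b, Set.mem_univ b, hab⟩
    have hle : G.deleteEdges {s(x, y)} ≤ G := SimpleGraph.deleteEdges_le _
    have hnadj : ¬ (G.deleteEdges {s(x, y)}).Adj x y := by simp [SimpleGraph.deleteEdges_adj]
    have hlt : G.deleteEdges {s(x, y)} < G := lt_of_le_of_ne hle fun h => hnadj (h.symm.le hxy)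
    refine PdLEOne.splineModule_of_edge hle (fun i j hij => ?_) hxy hnadj ?_
      (ih _ hlt (hG.deleteEdges hxy hpair))
    · by_cases h : s(i, j) = s(x, y)
      · exact Or.inr h
      · exact Or.inl ((SimpleGraph.deleteEdges_adj).2 ⟨hij, h⟩)
    · intro u v hxu hyu hyv hxv
      have huy : u ≠ y := by
        rintro rfl
        exact hnadj hxu
      have hvx : v ≠ x := by
        rintro rfl
        exact hnadj hyv.symm
      have hagree : ∀ {w z : V}, w ≠ x → w ≠ y → ∀ h : G.Adj z w,
          (G.deleteEdges {s(x, y)}).Adj z w := fun {w z} hwx hwy h => by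
        refine SimpleGraph.deleteEdges_adj.2 ⟨h, fun h' => ?_⟩
        rcases Sym2.eq_iff.1 h' with h' | h'
        · exact hwy h'.2
        · exact hwx h'.2
      exact hagree hvx hyv.ne' (hpair.adj_of_adj hxy (hle hxu)
        (fun h => hyu (hagree (hle hxu).ne' huy h)) huy (hle hyv)
        (fun h => hxv (hagree hvx (hle hyv).ne' h)) hvx)

end CoPairs

/-- If `G` is weakly chordal then the projective dimension of `D(A(G))` is at most 1. -/
theorem pd_le_one_of_weaklyChordal (ℓ : ℕ) (hℓ : 1 ≤ ℓ) (G : SimpleGraph (Fin ℓ))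
    (hG : WeaklyChordal G) :
    pd (ModuleCat.of (Spoly ℓ) (logDer ℓ G)) ≤ 1 := by
  exact (hG.pdLEOne_splineModule.of_equiv (logDerEquiv G).symm).pd_le_one
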